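/- arXiv:1007.2005 — 6 statements merged into one kernel-verified Lean document; each statement's English description precedes it below -/
import Mathlib

section
/- Let $n > 1$ and $p$ be a real number with $1 < p < n$, and let $u \in C_c^\infty(\mathbb{R}^n)$. Then $\int_{\mathbb{R}^n} \frac{|u(x)|^p}{\|x\|^p}\,dx \leq \left(\frac{p}{n-p}\right)^p \int_{\mathbb{R}^n} \|\nabla u(x)\|^p\,dx$. -/
open MeasureTheory

open scoped ENNReal

/-- Jensen's inequality for a weight `w`, in the form given by Hölder's inequality. -/
lemma rpow_lintegral_le_mul_lintegral_rpow_mul {α : Type*} [MeasurableSpace α] {μ : Measure α}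
    {p : ℝ} (hp : 1 < p) {f w : α → ℝ≥0∞} (hf : AEMeasurable f μ) (hw : AEMeasurable w μ)
    (hw0 : ∀ᵐ a ∂μ, w a ≠ 0) (hwt : ∀ᵐ a ∂μ, w a ≠ ∞) :
    (∫⁻ a, f a ∂μ) ^ p ≤ (∫⁻ a, w a ∂μ) ^ (p - 1) * ∫⁻ a, f a ^ p * w a ^ (1 - p) ∂μ := by
  have hp0 : 0 < p := by linarith
  have key := ENNReal.lintegral_mul_norm_pow_le (μ := μ)
    (f := fun a ↦ f a ^ p * w a ^ (1 - p)) (g := w) (p := 1 / p) (q := (p - 1) / p)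
    (by fun_prop) hw (by positivity) (div_nonneg (by linarith) hp0.le) (by field_simp; ring)
  have hfw : ∀ᵐ a ∂μ, f a = (f a ^ p * w a ^ (1 - p)) ^ (1 / p) * w a ^ ((p - 1) / p) := by
    filter_upwards [hw0, hwt] with a h0 ht
    rw [ENNReal.mul_rpow_of_nonneg _ _ (by positivity), ← ENNReal.rpow_mul, ← ENNReal.rpow_mul,
      mul_assoc, ← ENNReal.rpow_add _ _ h0 ht, mul_one_div_cancel hp0.ne',
      show (1 - p) * (1 / p) + (p - 1) / p = 0 by field_simp; ring]
    simp
  rw [← lintegral_congr_ae hfw] at key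
  calc (∫⁻ a, f a ∂μ) ^ p ≤ _ := ENNReal.rpow_le_rpow key hp0.le
    _ = _ := by
      rw [ENNReal.mul_rpow_of_nonneg _ _ hp0.le, ← ENNReal.rpow_mul, ← ENNReal.rpow_mul,
        one_div_mul_cancel hp0.ne', div_mul_cancel₀ _ hp0.ne', ENNReal.rpow_one, mul_comm]

lemma lintegral_Ioi_one_ofReal_rpow {a : ℝ} (ha : a < -1) :
    ∫⁻ t in Set.Ioi (1 : ℝ), ENNReal.ofReal t ^ a = ENNReal.ofReal (-(a + 1))⁻¹ := by
  have h : ∫⁻ t in Set.Ioi (1 : ℝ), ENNReal.ofReal t ^ a =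
      ∫⁻ t in Set.Ioi (1 : ℝ), ENNReal.ofReal (t ^ a) :=
    setLIntegral_congr_fun measurableSet_Ioi fun t ht ↦
      ENNReal.ofReal_rpow_of_pos (zero_lt_one.trans ht)
  rw [h, ← ofReal_integral_eq_lintegral_ofReal (integrableOn_Ioi_rpow_of_lt ha zero_lt_one),
    integral_Ioi_rpow_of_lt ha zero_lt_one]
  · rw [Real.one_rpow, inv_neg, ← one_div, neg_div]
  · exact (ae_restrict_iff' measurableSet_Ioi).2 <| .of_forall fun t ht ↦
      Real.rpow_nonneg (zero_lt_one.trans ht).le _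

section Dilation

variable {E : Type*} [NormedAddCommGroup E] [NormedSpace ℝ E] [FiniteDimensional ℝ E]
  [MeasurableSpace E] [BorelSpace E]

lemma lintegral_comp_smul_of_pos (μ : Measure E) [μ.IsAddHaarMeasure] {f : E → ℝ≥0∞}
    {t : ℝ} (ht : 0 < t) :
    ∫⁻ x, f (t • x) ∂μ =
      ENNReal.ofReal t ^ (-(Module.finrank ℝ E : ℝ)) * ∫⁻ x, f x ∂μ := by
  have h := lintegral_map_equiv (μ := μ) f
    (Homeomorph.smulOfNeZero t ht.ne' : E ≃ₜ E).toMeasurableEquiv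
  have h' : Measure.map (Homeomorph.smulOfNeZero t ht.ne' : E ≃ₜ E).toMeasurableEquiv μ =
      ENNReal.ofReal |(t ^ Module.finrank ℝ E)⁻¹| • μ := Measure.map_addHaar_smul μ ht.ne'
  rw [h', lintegral_smul_measure] at h
  rw [ENNReal.ofReal_rpow_of_pos ht, Real.rpow_neg ht.le, Real.rpow_natCast,
    ← abs_of_pos (inv_pos.2 (pow_pos ht _))]
  exact h.symm

/-- The averaging operator `f ↦ ∫₁^∞ f (t • x) dt` is bounded on `L^p` for `p < dim E`, with norm
at most `p / (dim E - p)`. -/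
lemma lintegral_rpow_lintegral_Ioi_comp_smul_le (μ : Measure E) [μ.IsAddHaarMeasure]
    {p : ℝ} (hp : 1 < p) (hpn : p < Module.finrank ℝ E) {f : E → ℝ≥0∞} (hf : Measurable f) :
    ∫⁻ x, (∫⁻ t in Set.Ioi (1 : ℝ), f (t • x)) ^ p ∂μ ≤
      ENNReal.ofReal (p / (Module.finrank ℝ E - p)) ^ p * ∫⁻ x, f x ^ p ∂μ := by
  set d : ℝ := (Module.finrank ℝ E : ℝ) with hd
  have hp0 : 0 < p := by linarith
  set C : ℝ≥0∞ := ENNReal.ofReal (p / (d - p)) with hC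
  have hC0 : C ≠ 0 := by
    simpa [hC] using div_pos hp0 (by linarith)
  have hw : ∫⁻ t in Set.Ioi (1 : ℝ), ENNReal.ofReal t ^ (-d / p) = C := by
    rw [lintegral_Ioi_one_ofReal_rpow (by rw [div_lt_iff₀ hp0]; linarith), hC]
    congr 1
    rw [show -(-d / p + 1) = (d - p) / p by field_simp; ring, inv_div]
  have hfm : Measurable fun q : E × ℝ ↦ f (q.2 • q.1) :=
    hf.comp (by fun_prop)
  calc ∫⁻ x, (∫⁻ t in Set.Ioi (1 : ℝ), f (t • x)) ^ p ∂μ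
    _ ≤ ∫⁻ x, C ^ (p - 1) * (∫⁻ t in Set.Ioi (1 : ℝ),
          f (t • x) ^ p * (ENNReal.ofReal t ^ (-d / p)) ^ (1 - p)) ∂μ := by
      refine lintegral_mono fun x ↦ ?_
      rw [← hw]
      refine rpow_lintegral_le_mul_lintegral_rpow_mul hp
        (hf.comp (by fun_prop)).aemeasurable (by fun_prop) ?_ ?_
      all_goals
        refine (ae_restrict_iff' measurableSet_Ioi).2 <| .of_forall fun t (ht : 1 < t) ↦ ?_
        have ht0 : 0 < t := zero_lt_one.trans ht
        rw [ENNReal.ofReal_rpow_of_pos ht0]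
      · simpa using Real.rpow_pos_of_pos ht0 _
      · exact ENNReal.ofReal_ne_top
    _ = C ^ (p - 1) * ∫⁻ t in Set.Ioi (1 : ℝ), ∫⁻ x,
          f (t • x) ^ p * (ENNReal.ofReal t ^ (-d / p)) ^ (1 - p) ∂μ := by
      rw [lintegral_const_mul' _ _ (by finiteness), lintegral_lintegral_swap]
      refine Measurable.aemeasurable ?_
      exact (hfm.pow_const p).mul (by fun_prop)
    _ = C ^ (p - 1) * ∫⁻ t in Set.Ioi (1 : ℝ),
          ENNReal.ofReal t ^ (-d / p) * ∫⁻ x, f x ^ p ∂μ := by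
      congr 1
      refine setLIntegral_congr_fun measurableSet_Ioi fun t (ht : 1 < t) ↦ ?_
      have ht0 : 0 < t := zero_lt_one.trans ht
      have h0 : ENNReal.ofReal t ≠ 0 := by simpa using ht0
      have hft : Measurable fun x ↦ f (t • x) := hf.comp (measurable_const_smul t)
      rw [lintegral_mul_const _ (hft.pow_const p),
        lintegral_comp_smul_of_pos (f := fun x ↦ f x ^ p) μ ht0, ← hd, mul_right_comm,
        ← ENNReal.rpow_mul, ← ENNReal.rpow_add _ _ h0 ENNReal.ofReal_ne_top]
      congr 2
      field_simp
      ring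
    _ = C ^ p * ∫⁻ x, f x ^ p ∂μ := by
      rw [lintegral_mul_const _ (by fun_prop), hw, ← mul_assoc]
      congr 1
      nth_rewrite 2 [← ENNReal.rpow_one C]
      rw [← ENNReal.rpow_add _ _ hC0 ENNReal.ofReal_ne_top, sub_add_cancel]

end Dilation

/-- A compactly supported `C¹` function is controlled by its derivative along the outward ray. -/
lemma HasCompactSupport.enorm_le_mul_lintegral_Ioi_enorm_fderiv {E F : Type*}
    [NormedAddCommGroup E] [NormedSpace ℝ E] [NormedAddCommGroup F] [NormedSpace ℝ F]
    [CompleteSpace F] {u : E → F} (hu : ContDiff ℝ 1 u) (hsupp : HasCompactSupport u)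
    {x : E} (hx : x ≠ 0) :
    ‖u x‖ₑ ≤ ‖x‖ₑ * ∫⁻ t in Set.Ioi (1 : ℝ), ‖fderiv ℝ u (t • x)‖ₑ := by
  have hcont : ContDiff ℝ 1 fun t : ℝ ↦ u (t • x) := by fun_prop
  have hcs : HasCompactSupport fun t : ℝ ↦ u (t • x) :=
    hsupp.comp_isClosedEmbedding (isClosedEmbedding_smul_left hx)
  have hderiv (t : ℝ) : deriv (fun t : ℝ ↦ u (t • x)) t = fderiv ℝ u (t • x) x := by
    have h1 : HasDerivAt (fun t : ℝ ↦ t • x) x t := by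
      simpa using (hasDerivAt_id t).smul_const x
    exact (((hu.differentiable one_ne_zero) (t • x)).hasFDerivAt.comp_hasDerivAt t h1).deriv
  have h := hcs.integral_Ioi_deriv_eq hcont 1
  rw [one_smul] at h
  rw [← enorm_neg, ← h, mul_comm, ← lintegral_mul_const' _ _ enorm_ne_top]
  refine (enorm_integral_le_lintegral_enorm _).trans (lintegral_mono fun t ↦ ?_)
  rw [hderiv]
  exact ContinuousLinearMap.le_opENorm _ _

/-- Sharp Hardy inequality for `1 < p < n`. -/
theorem hardy_inequality (n : ℕ) (hn : 1 < n) (p : ℝ) (hp1 : 1 < p) (hpn : p < n)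
    (u : EuclideanSpace ℝ (Fin n) → ℝ)
    (hu : ContDiff ℝ (⊤ : ℕ∞) u) (hsupp : HasCompactSupport u) :
    ∫ x, |u x| ^ p / ‖x‖ ^ p ≤
      (p / (n - p)) ^ p * ∫ x, ‖gradient u x‖ ^ p := by
  have hp0 : 0 < p := by linarith
  have hu1 : ContDiff ℝ 1 u := hu.of_le (by exact_mod_cast le_top)
  have hcont : Continuous (fderiv ℝ u) := hu1.continuous_fderiv one_ne_zero
  have hgrad (x) : ‖gradient u x‖ = ‖fderiv ℝ u x‖ := by
    rw [gradient, LinearIsometryEquiv.norm_map]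
  simp_rw [hgrad]
  have hint : Integrable fun x ↦ ‖fderiv ℝ u x‖ ^ p := by
    refine (hcont.norm.rpow_const fun _ ↦ .inr hp0.le).integrable_of_hasCompactSupport ?_
    exact (hsupp.fderiv (𝕜 := ℝ)).norm.comp_left (g := fun y : ℝ ↦ y ^ p)
      (Real.zero_rpow hp0.ne')
  have hC : 0 ≤ p / (n - p) := div_nonneg hp0.le (by linarith)
  have henorm {F : Type} [NormedAddCommGroup F] (y : F) :
      ENNReal.ofReal (‖y‖ ^ p) = ‖y‖ₑ ^ p := by
    rw [← ENNReal.ofReal_rpow_of_nonneg (norm_nonneg _) hp0.le, ofReal_norm]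
  rw [integral_eq_lintegral_of_nonneg_ae (.of_forall fun x ↦ by positivity)
    (by have := hu.continuous.measurable; exact Measurable.aestronglyMeasurable (by fun_prop))]
  refine ENNReal.toReal_le_of_le_ofReal (by positivity) ?_
  rw [ENNReal.ofReal_mul (by positivity), ← ENNReal.ofReal_rpow_of_nonneg hC hp0.le,
    ofReal_integral_eq_lintegral_ofReal hint (.of_forall fun x ↦ by positivity)]
  simp_rw [henorm]
  have hdim : (Module.finrank ℝ (EuclideanSpace ℝ (Fin n)) : ℝ) = n := by simp
  have hmain := lintegral_rpow_lintegral_Ioi_comp_smul_le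
    (volume : Measure (EuclideanSpace ℝ (Fin n))) hp1 (by rwa [hdim]) hcont.enorm.measurable
  rw [hdim] at hmain
  refine (lintegral_mono fun x ↦ ?_).trans hmain
  rcases eq_or_ne x 0 with rfl | hx
  · simp [Real.zero_rpow hp0.ne']
  · rw [ENNReal.ofReal_div_of_pos (by positivity), ← Real.norm_eq_abs, henorm, henorm,
      ← ENNReal.div_rpow_of_nonneg _ _ hp0.le]
    refine ENNReal.rpow_le_rpow (ENNReal.div_le_of_le_mul' ?_) hp0.le
    exact hsupp.enorm_le_mul_lintegral_Ioi_enorm_fderiv hu1 hx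
end

section
/- Let $n > 1$ and $p$ be a real number with $p > n$, and let $u \in C_c^\infty(\mathbb{R}^n \setminus \{0\})$. Then $\int_{\mathbb{R}^n} \frac{|u(x)|^p}{\|x\|^p}\,dx \leq \left(\frac{p}{p-n}\right)^p \int_{\mathbb{R}^n} \|\nabla u(x)\|^p\,dx$. -/
open MeasureTheory

/-- Integration of the radial derivative of a compactly supported `C¹` function. -/
lemma integral_fderiv_apply_self {E : Type*} [NormedAddCommGroup E] [NormedSpace ℝ E]
    [FiniteDimensional ℝ E] [MeasurableSpace E] [BorelSpace E] (μ : Measure E)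
    [μ.IsAddHaarMeasure] {v : E → ℝ} (hv : ContDiff ℝ 1 v) (hc : HasCompactSupport v) :
    ∫ x, fderiv ℝ v x x ∂μ = -(Module.finrank ℝ E : ℝ) * ∫ x, v x ∂μ := by
  let b := Module.finBasis ℝ E
  let ℓ : Fin (Module.finrank ℝ E) → E →L[ℝ] ℝ := fun i ↦ (b.coord i).toContinuousLinearMap
  have hexp : ∀ x, fderiv ℝ v x x = ∑ i, ℓ i x * fderiv ℝ v x (b i) := by
    intro x
    conv_lhs => rw [← b.sum_repr x, map_sum]
    simp [ℓ]
  have hcd : Continuous (fderiv ℝ v) := hv.continuous_fderiv one_ne_zero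
  have hint : ∀ i, Integrable (fun x ↦ ℓ i x * fderiv ℝ v x (b i)) μ := fun i ↦
    ((ℓ i).continuous.mul (hcd.clm_apply continuous_const)).integrable_of_hasCompactSupport
      (hc.fderiv_apply (𝕜 := ℝ) (b i)).mul_left
  have hself : ∀ i, ℓ i (b i) = 1 := fun i ↦ by simp [ℓ]
  have hpart : ∀ i, ∫ x, ℓ i x * fderiv ℝ v x (b i) ∂μ = -∫ x, v x ∂μ := by
    intro i
    rw [integral_mul_fderiv_eq_neg_fderiv_mul_of_integrable _ (hint i) _
      (fun x _ ↦ (ℓ i).differentiableAt) (fun x _ ↦ hv.differentiable one_ne_zero x)]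
    · simp [hself]
    · simpa [hself] using hv.continuous.integrable_of_hasCompactSupport hc
    · exact ((ℓ i).continuous.mul hv.continuous).integrable_of_hasCompactSupport hc.mul_left
  simp_rw [hexp]
  rw [integral_finsetSum _ fun i _ ↦ hint i]
  simp [hpart]

/-- A smooth function supported away from the origin stays smooth when divided by the norm. -/
lemma ContDiff.div_norm_of_tsupport_subset {E : Type*} [NormedAddCommGroup E]
    [InnerProductSpace ℝ E] {k : WithTop ℕ∞} {u : E → ℝ} (hu : ContDiff ℝ k u)
    (h0 : tsupport u ⊆ {(0 : E)}ᶜ) : ContDiff ℝ k (fun x ↦ u x / ‖x‖) := by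
  rw [contDiff_iff_contDiffAt]
  intro x
  by_cases hx : x ∈ tsupport u
  · have hx0 : x ≠ 0 := h0 hx
    exact hu.contDiffAt.div (contDiffAt_id.norm ℝ hx0) (norm_ne_zero_iff.2 hx0)
  · refine (contDiffAt_const (c := (0 : ℝ))).congr_of_eventuallyEq ?_
    filter_upwards [notMem_tsupport_iff_eventuallyEq.1 hx] with y hy
    simp [hy]

/-- For `w = u / ‖x‖`, the radial derivative of `u = ‖x‖ w` is `‖x‖ (w + x · ∇w)`, which bounds
`w + x · ∇w` by the gradient of `u`. -/
lemma abs_fderiv_div_norm_apply_self_add_le {E : Type*} [NormedAddCommGroup E]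
    [InnerProductSpace ℝ E] {u : E → ℝ} {x : E} (hu : DifferentiableAt ℝ u x) :
    |fderiv ℝ (fun y ↦ u y / ‖y‖) x x + u x / ‖x‖| ≤ ‖fderiv ℝ u x‖ := by
  rcases eq_or_ne x 0 with rfl | hx
  · simp
  have hn : ‖x‖ ≠ 0 := norm_ne_zero_iff.2 hx
  have hN : DifferentiableAt ℝ (fun y : E ↦ ‖y‖) x := differentiableAt_id.norm ℝ hx
  have hw : DifferentiableAt ℝ (fun y ↦ u y / ‖y‖) x := by
    simpa only [div_eq_mul_inv] using hu.fun_mul (hN.fun_inv hn)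
  have hprod : fderiv ℝ u x x = ‖x‖ * (fderiv ℝ (fun y ↦ u y / ‖y‖) x x + u x / ‖x‖) := by
    have heq : u =ᶠ[nhds x] fun y ↦ u y / ‖y‖ * ‖y‖ := by
      filter_upwards [eventually_ne_nhds hx] with y hy
      rw [div_mul_cancel₀ _ (norm_ne_zero_iff.2 hy)]
    rw [heq.fderiv_eq, fderiv_fun_mul hw hN]
    simp only [add_apply, smul_apply, smul_eq_mul, hN.fderiv_norm_self]
    ring
  have hle := (fderiv ℝ u x).le_opNorm x
  rw [hprod, norm_mul, norm_norm, mul_comm, Real.norm_eq_abs] at hle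
  exact le_of_mul_le_mul_right hle (norm_pos_iff.2 hx)

/-- Sharp Hardy inequality for `p > n`, for smooth functions compactly
supported away from the origin. -/
theorem hardy_inequality_p_gt_n (n : ℕ) (hn : 1 < n) (p : ℝ) (hpn : (n : ℝ) < p)
    (u : EuclideanSpace ℝ (Fin n) → ℝ)
    (hu : ContDiff ℝ (⊤ : ℕ∞) u) (hsupp : HasCompactSupport u)
    (h0 : tsupport u ⊆ {(0 : EuclideanSpace ℝ (Fin n))}ᶜ) :
    ∫ x, |u x| ^ p / ‖x‖ ^ p ≤
      (p / (p - n)) ^ p * ∫ x, ‖gradient u x‖ ^ p := by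
  have hp1 : 1 < p := lt_trans (by exact_mod_cast hn) hpn
  have hp0 : 0 < p := by linarith
  have hpn0 : 0 < p - n := by linarith
  set c : ℝ := p / (p - n) with hc
  have hc0 : 0 < c := by positivity
  have hcn : c * (p - n) = p := div_mul_cancel₀ _ hpn0.ne'
  have hu1 : ContDiff ℝ 1 u := hu.of_le (by exact_mod_cast le_top)
  set w : EuclideanSpace ℝ (Fin n) → ℝ := fun x ↦ u x / ‖x‖ with hw
  have hw1 : ContDiff ℝ 1 w := hu1.div_norm_of_tsupport_subset h0
  have hws : HasCompactSupport w :=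
    hsupp.mono fun x hx hux ↦ hx (by simp [hw, hux])
  have hwd : Differentiable ℝ w := hw1.differentiable one_ne_zero
  set v : EuclideanSpace ℝ (Fin n) → ℝ := fun x ↦ ‖w x‖ ^ p with hv
  have hv1 : ContDiff ℝ 1 v := hw1.norm_rpow hp1
  have hvs : HasCompactSupport v :=
    hws.mono fun x hx hwx ↦ hx (by simp [hv, hwx, hp0.ne'])
  have hvi : Integrable v := hv1.continuous.integrable_of_hasCompactSupport hvs
  have hgi : Integrable (fun x ↦ ‖fderiv ℝ u x‖ ^ p) := by
    refine Continuous.integrable_of_hasCompactSupport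
      ((hu1.continuous_fderiv one_ne_zero).norm.rpow_const fun _ ↦ Or.inr hp0.le) ?_
    exact (hsupp.fderiv (𝕜 := ℝ)).mono fun x hx hux ↦ hx (by simp [hux, hp0.ne'])
  have hdi : Integrable (fun x ↦ fderiv ℝ v x x) := by
    refine Continuous.integrable_of_hasCompactSupport
      ((hv1.continuous_fderiv one_ne_zero).clm_apply continuous_id) ?_
    exact (hvs.fderiv (𝕜 := ℝ)).mono fun x hx hvx ↦ hx (by simp [hvx])
  have hpt : ∀ x, c * fderiv ℝ v x x + c * p * v x ≤
      (p - 1) * v x + c ^ p * ‖fderiv ℝ u x‖ ^ p := by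
    intro x
    have hrad : |fderiv ℝ w x x + w x| ≤ ‖fderiv ℝ u x‖ :=
      abs_fderiv_div_norm_apply_self_add_le (hu1.differentiable one_ne_zero x)
    have hsq : |w x| ^ p = |w x| ^ (p - 2) * (w x * w x) := by
      rw [← abs_mul_abs_self, ← sq, ← Real.rpow_natCast,
        ← Real.rpow_add' (abs_nonneg _) (by simp [hp0.ne'])]
      simp
    have hpow : |w x| ^ (p - 1) = |w x| ^ (p - 2) * |w x| := by
      rw [← Real.rpow_add_one' (abs_nonneg _) (by linarith)]
      ring_nf
    have hdv : fderiv ℝ v x x + p * v x ≤ p * (|w x| ^ (p - 1) * ‖fderiv ℝ u x‖) := by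
      have hfd : fderiv ℝ v x x = p * |w x| ^ (p - 2) * (w x * fderiv ℝ w x x) := by
        rw [hv, hwd.fderiv_norm_rpow hp1]
        simp [mul_comm]
      calc fderiv ℝ v x x + p * v x
          = p * (|w x| ^ (p - 2) * (w x * (fderiv ℝ w x x + w x))) := by
            rw [hfd, hv]
            simp only [Real.norm_eq_abs]
            rw [hsq]
            ring
        _ ≤ p * (|w x| ^ (p - 2) * (|w x| * ‖fderiv ℝ u x‖)) := by
            have hprod : w x * (fderiv ℝ w x x + w x) ≤ |w x| * ‖fderiv ℝ u x‖ := by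
              refine (le_abs_self _).trans ?_
              rw [abs_mul]
              gcongr
            gcongr p * (|w x| ^ (p - 2) * ?_)
        _ = _ := by rw [hpow]; ring
    have hyoung := Real.young_inequality_of_nonneg
      (a := |w x| ^ (p - 1)) (b := c * ‖fderiv ℝ u x‖) (by positivity) (by positivity)
      (Real.HolderConjugate.conjExponent hp1).symm
    rw [← Real.rpow_mul (abs_nonneg _), Real.mul_rpow hc0.le (norm_nonneg _),
      Real.conjExponent, mul_div_cancel₀ _ (sub_pos.2 hp1).ne'] at hyoung
    have hyoung' : p * (|w x| ^ (p - 1) * (c * ‖fderiv ℝ u x‖)) ≤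
        (p - 1) * v x + c ^ p * ‖fderiv ℝ u x‖ ^ p := by
      refine (mul_le_mul_of_nonneg_left hyoung hp0.le).trans_eq ?_
      rw [hv]
      simp only [Real.norm_eq_abs]
      field_simp
    have := mul_le_mul_of_nonneg_left hdv hc0.le
    linarith
  have hmono := integral_mono ((hdi.const_mul c).add (hvi.const_mul (c * p)))
    ((hvi.const_mul (p - 1)).add (hgi.const_mul (c ^ p))) hpt
  rw [integral_add' (hdi.const_mul c) (hvi.const_mul (c * p)),
    integral_add' (hvi.const_mul (p - 1)) (hgi.const_mul (c ^ p))] at hmono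
  simp only [integral_const_mul] at hmono
  rw [integral_fderiv_apply_self volume hv1 hvs, finrank_euclideanSpace_fin] at hmono
  have hlhs : ∀ x, |u x| ^ p / ‖x‖ ^ p = v x := fun x ↦ by
    simp [hv, hw, Real.div_rpow (abs_nonneg _) (norm_nonneg _)]
  have hrhs : ∀ x, ‖gradient u x‖ = ‖fderiv ℝ u x‖ := fun x ↦ by simp [gradient]
  simp_rw [hlhs, hrhs]
  linear_combination hmono - (∫ x, v x) * hcn
end

section
/- Let $n \geq 3$, let $a$ be a real number with $a < \frac{n-2}{2}$, set $b = a+1$, and let $u \in C_c^\infty(\mathbb{R}^n)$. Then $\int_{\mathbb{R}^n} \frac{|u(x)|^2}{\|x\|^{2b}}\,dx \leq \frac{4}{(n-2-2a)^2} \int_{\mathbb{R}^n} \frac{\|\nabla u(x)\|^2}{\|x\|^{2a}}\,dx$. -/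
open MeasureTheory

section PowerWeights

open Set Filter Topology Metric Module

lemma sub_le_two_mul_mul_apply_add_mul_sq_div_norm_rpow {E : Type*}
    [NormedAddCommGroup E] [NormedSpace ℝ E] (L : E →L[ℝ] ℝ) (t a : ℝ) {k : ℝ}
    (hk : 0 < k) {x : E} (hx : x ≠ 0) :
    k / 2 * (t ^ 2 / ‖x‖ ^ (2 * (a + 1))) - 2 / k * (‖L‖ ^ 2 / ‖x‖ ^ (2 * a)) ≤
      (2 * t * L x + k * t ^ 2) / ‖x‖ ^ (2 * (a + 1)) := by
  have hx0 : 0 < ‖x‖ := norm_pos_iff.2 hx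
  have hpow : ‖x‖ ^ (2 * (a + 1)) = ‖x‖ ^ (2 * a) * ‖x‖ ^ 2 := by
    rw [← Real.rpow_natCast, ← Real.rpow_add hx0]
    push_cast
    ring_nf
  have hw : 0 < ‖x‖ ^ (2 * a) := Real.rpow_pos_of_pos hx0 _
  have hL : ‖L‖ ^ 2 / ‖x‖ ^ (2 * a) = (‖L‖ * ‖x‖) ^ 2 / ‖x‖ ^ (2 * (a + 1)) := by
    rw [hpow]
    field_simp
  have hle : L x ^ 2 ≤ (‖L‖ * ‖x‖) ^ 2 :=
    sq_le_sq' (neg_le_of_abs_le (L.le_opNorm x)) (le_of_abs_le (L.le_opNorm x))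
  rw [hL, ← mul_div_assoc, ← mul_div_assoc, ← sub_div]
  gcongr
  have h1 : 2 / k * L x ^ 2 ≤ 2 / k * (‖L‖ * ‖x‖) ^ 2 := by gcongr
  have h2 : 0 ≤ 2 / k * (L x + k / 2 * t) ^ 2 := by positivity
  have h3 : 2 / k * (L x + k / 2 * t) ^ 2 =
      2 / k * L x ^ 2 + 2 * t * L x + k / 2 * t ^ 2 := by
    field_simp
    ring
  linarith

variable {E : Type*} [NormedAddCommGroup E] [NormedSpace ℝ E] [FiniteDimensional ℝ E]
  [Nontrivial E] [MeasurableSpace E] [BorelSpace E] (μ : Measure E) [μ.IsAddHaarMeasure]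

lemma integral_eq_integral_toSphere_integral_Ioi {F : Type*} [NormedAddCommGroup F]
    [NormedSpace ℝ F] {f : E → F} (hf : Integrable f μ) :
    ∫ x, f x ∂μ = ∫ ω, ∫ r in Ioi (0 : ℝ), r ^ (finrank ℝ E - 1) • f (r • (ω : E)) ∂volume
      ∂μ.toSphere := by
  have hmp := μ.measurePreserving_homeomorphUnitSphereProd
  have hemb := (homeomorphUnitSphereProd E).measurableEmbedding
  set g : sphere (0 : E) 1 × Ioi (0 : ℝ) → F := fun p ↦ f ((p.2 : ℝ) • (p.1 : E)) with hg
  have hge : ∀ x, g (homeomorphUnitSphereProd E x) = f x := fun x ↦ by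
    have h := congrArg Subtype.val ((homeomorphUnitSphereProd E).symm_apply_apply x)
    rw [homeomorphUnitSphereProd_symm_apply_coe] at h
    simp only [hg, h]
  have hgi : Integrable g (μ.toSphere.prod (.volumeIoiPow (finrank ℝ E - 1))) := by
    rw [← hmp.integrable_comp_emb hemb]
    have h := hf.integrableOn (s := ({0}ᶜ : Set E))
    rw [integrableOn_iff_comap_subtypeVal (by measurability)] at h
    exact h.congr (.of_forall fun x ↦ (hge x).symm)
  calc
    ∫ x, f x ∂μ = ∫ x : ({(0)}ᶜ : Set E), f x ∂(μ.comap (↑)) := by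
      rw [integral_subtype_comap (measurableSet_singleton _).compl f, restrict_compl_singleton]
    _ = ∫ p, g p ∂μ.toSphere.prod (.volumeIoiPow (finrank ℝ E - 1)) := by
      rw [← hmp.integral_comp hemb]
      simp only [hge]
    _ = _ := by
      rw [integral_prod _ hgi]
      congr 1 with ω
      simp only [Measure.volumeIoiPow, ENNReal.ofReal, hg]
      rw [integral_withDensity_eq_integral_smul,
        integral_subtype_comap measurableSet_Ioi
          fun r ↦ Real.toNNReal (r ^ (finrank ℝ E - 1)) • f (r • (ω : E)),
        setIntegral_congr_fun measurableSet_Ioi fun x hx ↦ ?_]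
      · rw [NNReal.smul_def, Real.coe_toNNReal _ (pow_nonneg hx.out.le _)]
      · exact (measurable_subtype_coe.pow_const _).real_toNNReal

lemma integrableOn_ball_norm_rpow {s : ℝ} (hs : -(finrank ℝ E : ℝ) < s) (R : ℝ) :
    IntegrableOn (fun x : E ↦ ‖x‖ ^ s) (ball 0 R) μ := by
  have hd : 1 ≤ finrank ℝ E := finrank_pos
  rw [integrableOn_fun_norm_addHaar μ (f := fun r ↦ r ^ s)]
  have h : IntegrableOn (fun r : ℝ ↦ r ^ ((finrank ℝ E : ℝ) - 1 + s)) (Ioo 0 R) :=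
    (intervalIntegral.intervalIntegrable_rpow' (by linarith) (a := 0) (b := R)).1.mono_set
      Ioo_subset_Ioc_self
  refine h.congr_fun (fun r hr ↦ ?_) measurableSet_Ioo
  simp only [smul_eq_mul]
  rw [Real.rpow_add hr.1, ← Real.rpow_natCast, Nat.cast_sub hd, Nat.cast_one]

lemma HasCompactSupport.integrable_div_norm_rpow {f : E → ℝ} (hf : Continuous f)
    (hfs : HasCompactSupport f) {s : ℝ} (hs : s < finrank ℝ E) :
    Integrable (fun x ↦ f x / ‖x‖ ^ s) μ := by
  obtain ⟨R, hR⟩ := hfs.isCompact.isBounded.subset_ball (0 : E)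
  obtain ⟨C, hC⟩ := hf.bounded_above_of_compact_support hfs
  have hw := integrableOn_ball_norm_rpow μ (neg_lt_neg hs) R
  have h : IntegrableOn (fun x ↦ f x * ‖x‖ ^ (-s)) (ball 0 R) μ :=
    hw.bdd_mul hf.aestronglyMeasurable (.of_forall hC)
  rw [integrableOn_iff_integrable_of_support_subset] at h
  · simpa only [Real.rpow_neg (norm_nonneg _), div_eq_mul_inv] using h
  · intro x hx
    exact hR (subset_tsupport f (left_ne_zero_of_mul hx))

lemma integrable_fderiv_self_add_mul_div_norm_rpow {g : E → ℝ} (hg : ContDiff ℝ 1 g)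
    (hgs : HasCompactSupport g) {s : ℝ} (hs : s < finrank ℝ E) :
    Integrable (fun x ↦ (fderiv ℝ g x x + (finrank ℝ E - s) * g x) / ‖x‖ ^ s) μ := by
  have hcont : Continuous fun x ↦ fderiv ℝ g x x :=
    (hg.continuous_fderiv one_ne_zero).clm_apply continuous_id
  have hsupp : HasCompactSupport fun x ↦ fderiv ℝ g x x :=
    (hgs.fderiv (𝕜 := ℝ)).mono fun x hx h ↦ hx (by simp [h])
  exact HasCompactSupport.integrable_div_norm_rpow μ
    (hcont.add (continuous_const.mul hg.continuous))
    (hsupp.add (hgs.mul_left (f := fun _ ↦ (finrank ℝ E : ℝ) - s))) hs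

/-- The divergence of `x ↦ (g x / ‖x‖ ^ s) • x` has zero integral. -/
lemma integral_fderiv_self_add_mul_div_norm_rpow {g : E → ℝ} (hg : ContDiff ℝ 1 g)
    (hgs : HasCompactSupport g) {s : ℝ} (hs : s < finrank ℝ E) :
    ∫ x, (fderiv ℝ g x x + (finrank ℝ E - s) * g x) / ‖x‖ ^ s ∂μ = 0 := by
  have hd : 1 ≤ finrank ℝ E := finrank_pos
  rw [integral_eq_integral_toSphere_integral_Ioi μ
    (integrable_fderiv_self_add_mul_div_norm_rpow μ hg hgs hs)]
  refine integral_eq_zero_of_ae (.of_forall fun ω ↦ ?_)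
  set φ : ℝ → ℝ := fun r ↦ g (r • (ω : E)) * r ^ ((finrank ℝ E : ℝ) - s)
  have hω : ‖(ω : E)‖ = 1 := by simp
  have hgc : Continuous fun r : ℝ ↦ g (r • (ω : E)) := by have := hg.continuous; fun_prop
  have hφ : Continuous φ := hgc.mul (Real.continuous_rpow_const (by linarith))
  have hderiv : ∀ r ∈ Ioi (0 : ℝ), HasDerivAt φ (r ^ (finrank ℝ E - 1) •
      ((fderiv ℝ g (r • (ω : E)) (r • (ω : E)) + (finrank ℝ E - s) * g (r • (ω : E))) /
        ‖r • (ω : E)‖ ^ s)) r := by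
    intro r (hr : 0 < r)
    have h1 : HasDerivAt (fun r : ℝ ↦ r • (ω : E)) (ω : E) r := by
      simpa using (hasDerivAt_id r).smul_const (ω : E)
    have h2 := ((hg.differentiable one_ne_zero _).hasFDerivAt.comp_hasDerivAt r h1).mul
      (Real.hasDerivAt_rpow_const (p := (finrank ℝ E : ℝ) - s) (Or.inl hr.ne'))
    refine h2.congr_deriv ?_
    have hpow : r ^ (finrank ℝ E - 1) = r ^ ((finrank ℝ E : ℝ) - s - 1) * r ^ s := by
      rw [← Real.rpow_add hr, ← Real.rpow_natCast, Nat.cast_sub hd, Nat.cast_one]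
      ring_nf
    have hpow' : r ^ ((finrank ℝ E : ℝ) - s) = r ^ ((finrank ℝ E : ℝ) - s - 1) * r := by
      rw [← Real.rpow_add_one hr.ne']
      ring_nf
    have : r ^ s ≠ 0 := (Real.rpow_pos_of_pos hr s).ne'
    rw [norm_smul, hω, mul_one, Real.norm_of_nonneg hr.le, hpow, hpow', map_smul]
    simp only [smul_eq_mul, Function.comp_apply]
    field_simp
  have hlim : Tendsto φ atTop (𝓝 0) := by
    obtain ⟨R, hR⟩ := hgs.isCompact.isBounded.subset_ball (0 : E)
    refine tendsto_const_nhds.congr' ?_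
    filter_upwards [eventually_ge_atTop R, eventually_ge_atTop 0] with r hr hr0
    have : g (r • (ω : E)) = 0 := by
      by_contra h
      have := hR (subset_tsupport g h)
      rw [mem_ball_zero_iff, norm_smul, hω, mul_one, Real.norm_of_nonneg hr0] at this
      linarith
    simp [φ, this]
  by_cases hφi : IntegrableOn (fun r : ℝ ↦ r ^ (finrank ℝ E - 1) •
      ((fderiv ℝ g (r • (ω : E)) (r • (ω : E)) + (finrank ℝ E - s) * g (r • (ω : E))) /
        ‖r • (ω : E)‖ ^ s)) (Ioi 0)
  · have h := integral_Ioi_of_hasDerivAt_of_tendsto hφ.continuousWithinAt hderiv hφi hlim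
    have h0 : φ 0 = 0 := by simp [φ, Real.zero_rpow (sub_pos.2 hs).ne']
    rw [h0, sub_zero] at h
    exact h
  · exact integral_undef hφi

theorem integral_sq_div_norm_rpow_le {u : E → ℝ} (hu : ContDiff ℝ 1 u)
    (hsupp : HasCompactSupport u) {a : ℝ} (ha : 2 * (a + 1) < finrank ℝ E) :
    ∫ x, u x ^ 2 / ‖x‖ ^ (2 * (a + 1)) ∂μ ≤ 4 / ((finrank ℝ E : ℝ) - 2 * (a + 1)) ^ 2 *
      ∫ x, ‖fderiv ℝ u x‖ ^ 2 / ‖x‖ ^ (2 * a) ∂μ := by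
  set k : ℝ := (finrank ℝ E : ℝ) - 2 * (a + 1) with hk
  have hk0 : 0 < k := sub_pos.2 ha
  have hfd : Continuous (fderiv ℝ u) := hu.continuous_fderiv one_ne_zero
  have husq : HasCompactSupport fun x ↦ u x ^ 2 :=
    hsupp.comp_left (g := fun t : ℝ ↦ t ^ 2) (by simp)
  have hP : Integrable (fun x ↦ u x ^ 2 / ‖x‖ ^ (2 * (a + 1))) μ :=
    husq.integrable_div_norm_rpow μ (by have := hu.continuous; fun_prop) ha
  have hQ : Integrable (fun x ↦ ‖fderiv ℝ u x‖ ^ 2 / ‖x‖ ^ (2 * a)) μ :=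
    HasCompactSupport.integrable_div_norm_rpow μ (f := fun x ↦ ‖fderiv ℝ u x‖ ^ 2) (by fun_prop)
      ((hsupp.fderiv (𝕜 := ℝ)).comp_left (g := fun L : E →L[ℝ] ℝ ↦ ‖L‖ ^ 2) (by simp)) (by linarith)
  have hderiv (x : E) : fderiv ℝ (fun y ↦ u y ^ 2) x x = 2 * u x * fderiv ℝ u x x := by
    rw [fderiv_fun_pow 2 (hu.differentiable one_ne_zero x)]
    simp
  have hdiv := integral_fderiv_self_add_mul_div_norm_rpow μ (g := fun x ↦ u x ^ 2) (hu.pow 2) husq ha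
  rw [← hk] at hdiv
  have hH := integrable_fderiv_self_add_mul_div_norm_rpow μ (g := fun x ↦ u x ^ 2) (hu.pow 2) husq ha
  rw [← hk] at hH
  have key : ∫ x, k / 2 * (u x ^ 2 / ‖x‖ ^ (2 * (a + 1))) -
      2 / k * (‖fderiv ℝ u x‖ ^ 2 / ‖x‖ ^ (2 * a)) ∂μ ≤ 0 := by
    rw [← hdiv]
    refine integral_mono_ae ((hP.const_mul _).sub (hQ.const_mul _)) hH ?_
    filter_upwards [Measure.ae_ne μ (0 : E)] with x hx
    rw [hderiv]
    exact sub_le_two_mul_mul_apply_add_mul_sq_div_norm_rpow _ _ _ hk0 hx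
  rw [integral_sub (hP.const_mul _) (hQ.const_mul _), integral_const_mul, integral_const_mul,
    sub_nonpos] at key
  calc
    _ = 2 / k * (k / 2 * ∫ x, u x ^ 2 / ‖x‖ ^ (2 * (a + 1)) ∂μ) := by field_simp
    _ ≤ 2 / k * (2 / k * ∫ x, ‖fderiv ℝ u x‖ ^ 2 / ‖x‖ ^ (2 * a) ∂μ) := by gcongr
    _ = _ := by
      field_simp
      ring

end PowerWeights

/-- Caffarelli-Kohn-Nirenberg inequality in the endpoint case `b = a + 1`,
with the sharp constant `4 / (n - 2 - 2a)^2`. -/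
theorem ckn_b_eq_a_add_one (n : ℕ) (hn : 3 ≤ n) (a b : ℝ)
    (ha : a < ((n : ℝ) - 2) / 2) (hb : b = a + 1)
    (u : EuclideanSpace ℝ (Fin n) → ℝ)
    (hu : ContDiff ℝ (⊤ : ℕ∞) u) (hsupp : HasCompactSupport u) :
    ∫ x, |u x| ^ 2 / ‖x‖ ^ (2 * b) ≤
      4 / ((n : ℝ) - 2 - 2 * a) ^ 2 *
        ∫ x, ‖gradient u x‖ ^ 2 / ‖x‖ ^ (2 * a) := by
  subst hb
  have : Nonempty (Fin n) := ⟨⟨0, by omega⟩⟩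
  have hgrad (x : EuclideanSpace ℝ (Fin n)) : ‖gradient u x‖ = ‖fderiv ℝ u x‖ := by
    rw [← toDual_gradient, LinearIsometryEquiv.norm_map]
  have h := integral_sq_div_norm_rpow_le volume (hu.of_le (by exact_mod_cast le_top)) hsupp
    (a := a) (by rw [finrank_euclideanSpace_fin]; linarith)
  rw [finrank_euclideanSpace_fin, show (n : ℝ) - 2 * (a + 1) = n - 2 - 2 * a by ring] at h
  simpa only [sq_abs, hgrad] using h
end

section
/- Let $n \geq 3$, let $a$ be a real number with $a \leq 0$, and set $p = \frac{2n}{n-2}$. Suppose $K > 0$ is a constant such that the Sobolev inequality $\left(\int_{\mathbb{R}^n} |f(x)|^p dx\right)^{1/p} \leq K \left(\int_{\mathbb{R}^n} \|\nabla f(x)\|^2 dx\right)^{1/2}$ holds for all $f \in C_c^\infty(\mathbb{R}^n \setminus \{0\})$. Then for every $u \in C_c^\infty(\mathbb{R}^n)$, $\left(\int_{\mathbb{R}^n} \frac{|u(x)|^p}{\|x\|^{ap}}\,dx\right)^{2/p} \leq K^2 \left(\frac{n-2-4a}{n-2-2a}\right)^2 \int_{\mathbb{R}^n} \frac{\|\nabla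 u(x)\|^2}{\|x\|^{2a}}\,dx$. -/
open MeasureTheory

section
variable {F : Type*} [NormedAddCommGroup F] [InnerProductSpace ℝ F]

theorem contDiff_norm_rpow_mul (s : ℝ) {v : F → ℝ} (hv : ContDiff ℝ (⊤ : ℕ∞) v)
    (h0 : tsupport v ⊆ {(0 : F)}ᶜ) : ContDiff ℝ (⊤ : ℕ∞) (fun x => ‖x‖ ^ s * v x) := by
  rw [contDiff_iff_contDiffAt]
  intro x
  by_cases hx : x ∈ tsupport v
  · have hx0 : x ≠ 0 := h0 hx
    exact ((contDiffAt_id.norm ℝ hx0).rpow_const_of_ne (norm_ne_zero_iff.2 hx0)).mul hv.contDiffAt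
  · refine (contDiffAt_const (c := (0 : ℝ))).congr_of_eventuallyEq ?_
    filter_upwards [notMem_tsupport_iff_eventuallyEq.1 hx] with y hy
    simp [hy]

theorem hasFDerivAt_norm_rpow_of_ne (s : ℝ) {x : F} (hx : x ≠ 0) :
    HasFDerivAt (fun y : F => ‖y‖ ^ s) ((s * ‖x‖ ^ (s - 2)) • innerSL ℝ x) x := by
  have h := (hasStrictFDerivAt_norm_sq x).hasFDerivAt.rpow_const (p := s / 2)
    (Or.inl (by simpa using hx))
  have e : (fun y : F => (‖y‖ ^ 2) ^ (s / 2)) = fun y : F => ‖y‖ ^ s := by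
    funext y
    rw [← Real.rpow_natCast_mul (norm_nonneg y)]
    congr 1
    push_cast
    ring
  rw [e] at h
  convert h using 1
  rw [← Real.rpow_natCast_mul (norm_nonneg x), ← Nat.cast_smul_eq_nsmul ℝ, smul_smul]
  congr 1
  push_cast
  rw [show (2 : ℝ) * (s / 2 - 1) = s - 2 by ring]
  ring

theorem fderiv_norm_rpow_mul (s : ℝ) {v : F → ℝ} {x : F} (hv : DifferentiableAt ℝ v x)
    (hx : x ≠ 0) :
    fderiv ℝ (fun y => ‖y‖ ^ s * v y) x =
      ‖x‖ ^ s • fderiv ℝ v x + v x • (s * ‖x‖ ^ (s - 2)) • innerSL ℝ x :=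
  ((hasFDerivAt_norm_rpow_of_ne s hx).mul hv.hasFDerivAt).fderiv

theorem norm_smul_fderiv_add_smul_innerSL_sq [CompleteSpace F] (v : F → ℝ) (x : F) (c d : ℝ) :
    ‖c • fderiv ℝ v x + d • innerSL ℝ x‖ ^ 2 =
      c ^ 2 * ‖gradient v x‖ ^ 2 + 2 * c * d * fderiv ℝ v x x + d ^ 2 * ‖x‖ ^ 2 := by
  have h : c • fderiv ℝ v x + d • innerSL ℝ x =
      InnerProductSpace.toDual ℝ F (c • gradient v x + d • x) := by
    ext y
    simp
  rw [h, LinearIsometryEquiv.norm_map, norm_add_sq_real, norm_smul, norm_smul, mul_pow, mul_pow,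
    inner_smul_left, inner_smul_right, inner_gradient_left]
  simp
  ring

theorem norm_gradient_eq_norm_fderiv [CompleteSpace F] (v : F → ℝ) (x : F) :
    ‖gradient v x‖ = ‖fderiv ℝ v x‖ := by
  simp [gradient]

theorem norm_gradient_norm_rpow_mul_sq [CompleteSpace F] (s : ℝ) {v : F → ℝ}
    {x : F} (hv : DifferentiableAt ℝ v x) (hx : x ≠ 0) :
    ‖gradient (fun y => ‖y‖ ^ s * v y) x‖ ^ 2 =
      ‖x‖ ^ (2 * s) * ‖gradient v x‖ ^ 2
        + s * fderiv ℝ (fun y => ‖y‖ ^ (2 * s - 2) * v y ^ 2) x x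
        + (2 * s - s ^ 2) * (‖x‖ ^ (2 * s - 2) * v x ^ 2) := by
  have hpos : 0 < ‖x‖ := norm_pos_iff.2 hx
  have e1 : ‖x‖ ^ (2 * s) = (‖x‖ ^ s) ^ 2 := by
    rw [← Real.rpow_mul_natCast hpos.le]; push_cast; ring_nf
  have e2 : ‖x‖ ^ (2 * s - 2) = (‖x‖ ^ s) ^ 2 / ‖x‖ ^ 2 := by
    rw [Real.rpow_sub hpos, e1]; norm_num
  have e3 : ‖x‖ ^ (s - 2) = ‖x‖ ^ s / ‖x‖ ^ 2 := by
    rw [Real.rpow_sub hpos]; norm_num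
  have e4 : ‖x‖ ^ (2 * s - 2 - 2) = (‖x‖ ^ s) ^ 2 / ‖x‖ ^ 2 / ‖x‖ ^ 2 := by
    rw [Real.rpow_sub hpos, e2]; norm_num
  have hd : fderiv ℝ (fun y => v y ^ 2) x x = 2 * v x * fderiv ℝ v x x := by
    rw [fderiv_fun_pow 2 hv]; simp
  rw [norm_gradient_eq_norm_fderiv, fderiv_norm_rpow_mul s hv hx, smul_smul,
    norm_smul_fderiv_add_smul_innerSL_sq,
    fderiv_norm_rpow_mul (v := fun y => v y ^ 2) _ (hv.pow 2) hx]
  simp only [add_apply, smul_apply, hd, smul_eq_mul,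
    innerSL_apply_apply, real_inner_self_eq_norm_sq, e1, e2, e3, e4]
  field_simp
  ring

end

section
variable {n : ℕ}

theorem integral_fderiv_apply_self_s5 {ψ : EuclideanSpace ℝ (Fin n) → ℝ} (hψ : ContDiff ℝ 1 ψ)
    (hs : HasCompactSupport ψ) : ∫ x, fderiv ℝ ψ x x = -(n * ∫ x, ψ x) := by
  have hd : Continuous (fderiv ℝ ψ) := hψ.continuous_fderiv one_ne_zero
  let b := EuclideanSpace.basisFun (Fin n) ℝ
  have hint (i : Fin n) : Integrable fun x : EuclideanSpace ℝ (Fin n) =>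
      x i * fderiv ℝ ψ x (b i) :=
    Continuous.integrable_of_hasCompactSupport (by fun_prop)
      ((hs.fderiv_apply ℝ (b i)).mul_left)
  have hsum (x : EuclideanSpace ℝ (Fin n)) :
      fderiv ℝ ψ x x = ∑ i, x i * fderiv ℝ ψ x (b i) := by
    conv_lhs => enter [2]; rw [← b.sum_repr x]
    simp [b]
  have hcoord (i : Fin n) : ∫ x : EuclideanSpace ℝ (Fin n), x i * fderiv ℝ ψ x (b i) =
      -∫ x, ψ x := by
    have hf (x : EuclideanSpace ℝ (Fin n)) :
        fderiv ℝ (fun y : EuclideanSpace ℝ (Fin n) => y i) x (b i) = 1 := by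
      have : HasFDerivAt (fun y : EuclideanSpace ℝ (Fin n) => y i)
        (EuclideanSpace.proj i : EuclideanSpace ℝ (Fin n) →L[ℝ] ℝ) x :=
        (EuclideanSpace.proj i : EuclideanSpace ℝ (Fin n) →L[ℝ] ℝ).hasFDerivAt
      rw [this.fderiv]
      simp [b]
    rw [integral_mul_fderiv_eq_neg_fderiv_mul_of_integrable _ (hint i)]
    · simp [hf]
    · exact Continuous.integrable_of_hasCompactSupport (by fun_prop) hs.mul_left
    · intro x _; fun_prop
    · intro x _; exact hψ.differentiable one_ne_zero x
    · simpa [hf] using hψ.continuous.integrable_of_hasCompactSupport hs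
  simp_rw [hsum]
  rw [integral_finsetSum _ fun i _ => hint i]
  simp [hcoord]

theorem integrable_norm_rpow_mul_norm_gradient_sq {s : ℝ} (h_s : 0 ≤ s)
    {v : EuclideanSpace ℝ (Fin n) → ℝ} (hv : ContDiff ℝ (⊤ : ℕ∞) v) (hc : HasCompactSupport v) :
    Integrable fun x => ‖x‖ ^ s * ‖gradient v x‖ ^ 2 := by
  have hvd : Continuous (fderiv ℝ v) := hv.continuous_fderiv (by simp)
  simp_rw [norm_gradient_eq_norm_fderiv]
  refine Continuous.integrable_of_hasCompactSupport ?_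
    ((hc.fderiv ℝ).mono fun x hx h => hx (by simp [h]))
  exact (continuous_norm.rpow_const fun x => Or.inr h_s).mul (hvd.norm.pow 2)

theorem integral_norm_gradient_norm_rpow_mul_le (hn : 2 ≤ n) {s : ℝ} (h_s : 0 ≤ s)
    {v : EuclideanSpace ℝ (Fin n) → ℝ} (hv : ContDiff ℝ (⊤ : ℕ∞) v) (hc : HasCompactSupport v)
    (h0 : tsupport v ⊆ {(0 : EuclideanSpace ℝ (Fin n))}ᶜ) :
    ∫ x, ‖gradient (fun y => ‖y‖ ^ s * v y) x‖ ^ 2 ≤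
      ∫ x, ‖x‖ ^ (2 * s) * ‖gradient v x‖ ^ 2 := by
  have : Nontrivial (EuclideanSpace ℝ (Fin n)) := by
    have : Nonempty (Fin n) := ⟨⟨0, by omega⟩⟩
    infer_instance
  set ψ : EuclideanSpace ℝ (Fin n) → ℝ := fun y => ‖y‖ ^ (2 * s - 2) * v y ^ 2
  have hψs : ContDiff ℝ (⊤ : ℕ∞) ψ := by
    refine contDiff_norm_rpow_mul _ (hv.pow 2) (subset_trans (closure_mono ?_) h0)
    intro x hx
    simpa using hx
  have hψc : HasCompactSupport ψ := by
    refine hc.mono fun x hx h => hx ?_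
    simp [ψ, h]
  have hψ1 : ContDiff ℝ 1 ψ := hψs.of_le (by simp)
  have hfd : Continuous (fderiv ℝ ψ) := hψ1.continuous_fderiv one_ne_zero
  have hI1 := integrable_norm_rpow_mul_norm_gradient_sq (s := 2 * s) (by positivity) hv hc
  have hI2 : Integrable fun x => fderiv ℝ ψ x x :=
    Continuous.integrable_of_hasCompactSupport (by fun_prop)
      ((hψc.fderiv ℝ).mono fun x hx h => hx (by simp [h]))
  have hI3 : Integrable ψ := hψ1.continuous.integrable_of_hasCompactSupport hψc
  have key : ∫ x, ‖gradient (fun y => ‖y‖ ^ s * v y) x‖ ^ 2 =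
      ∫ x, (‖x‖ ^ (2 * s) * ‖gradient v x‖ ^ 2 + s * fderiv ℝ ψ x x + (2 * s - s ^ 2) * ψ x) := by
    refine integral_congr_ae ?_
    filter_upwards [compl_mem_ae_iff.2 (measure_singleton (0 : EuclideanSpace ℝ (Fin n)))] with x hx
    exact norm_gradient_norm_rpow_mul_sq s (hv.differentiable (by simp) x) hx
  have hI12 : Integrable fun x => ‖x‖ ^ (2 * s) * ‖gradient v x‖ ^ 2 + s * fderiv ℝ ψ x x :=
    hI1.add (hI2.const_mul s)
  rw [key, integral_add hI12 (hI3.const_mul _), integral_add hI1 (hI2.const_mul s),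
    integral_const_mul, integral_const_mul,
    integral_fderiv_apply_self_s5 hψ1 hψc]
  have hnn : 0 ≤ ∫ x, ψ x := integral_nonneg fun x => by positivity
  have hn' : (2 : ℝ) ≤ n := by exact_mod_cast hn
  nlinarith [mul_nonneg (mul_nonneg h_s hnn) (sub_nonneg.2 hn'), mul_nonneg (sq_nonneg s) hnn]
theorem exists_cutoff_at_zero :
    ∃ (M : ℝ) (η : ℕ → EuclideanSpace ℝ (Fin n) → ℝ), 0 ≤ M ∧
      (∀ k, ContDiff ℝ (⊤ : ℕ∞) (η k)) ∧ (∀ k x, 0 ≤ η k x) ∧ (∀ k x, η k x ≤ 1) ∧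
      (∀ k, η k =ᶠ[nhds 0] 0) ∧ (∀ x ≠ 0, ∀ᶠ k in Filter.atTop, η k x = 1) ∧
      (∀ k x, ‖fderiv ℝ (η k) x‖ ≤ M * (k + 1)) ∧
      (∀ k : ℕ, ∀ x : EuclideanSpace ℝ (Fin n), x ∉ Metric.closedBall 0 (2 / ((k : ℝ) + 1)) →
        fderiv ℝ (η k) x = 0) := by
  let b : ContDiffBump (0 : EuclideanSpace ℝ (Fin n)) := ⟨1, 2, one_pos, one_lt_two⟩
  have hbs : ContDiff ℝ (⊤ : ℕ∞) b := b.contDiff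
  have hbd : Continuous (fderiv ℝ b) := hbs.continuous_fderiv (by simp)
  obtain ⟨M, hM⟩ := (b.hasCompactSupport.fderiv ℝ).exists_bound_of_continuous hbd
  have hk (k : ℕ) : (0 : ℝ) < k + 1 := by positivity
  have hfd (k : ℕ) (x : EuclideanSpace ℝ (Fin n)) :
      fderiv ℝ (fun x => 1 - b (((k : ℝ) + 1) • x)) x =
        -(((k : ℝ) + 1) • fderiv ℝ b (((k : ℝ) + 1) • x)) := by
    rw [fderiv_const_sub, fderiv_comp_smul]
  refine ⟨M, fun k x => 1 - b (((k : ℝ) + 1) • x), (norm_nonneg _).trans (hM 0), fun k => ?_,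
    fun k x => sub_nonneg.2 b.le_one, fun k x => sub_le_self _ b.nonneg, fun k => ?_,
    fun x hx => ?_, fun k x => ?_, fun k x hx => ?_⟩
  · exact contDiff_const.sub (hbs.comp (contDiff_const_smul _))
  · have h : Filter.Tendsto (fun x : EuclideanSpace ℝ (Fin n) => ((k : ℝ) + 1) • x)
        (nhds 0) (nhds 0) := by
      have : Continuous fun x : EuclideanSpace ℝ (Fin n) => ((k : ℝ) + 1) • x := by fun_prop
      simpa using this.tendsto 0
    filter_upwards [h.eventually b.eventuallyEq_one] with x hx
    simpa [sub_eq_zero] using hx.symm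
  · have hx' := norm_pos_iff.2 hx
    filter_upwards [Filter.eventually_ge_atTop ⌈2 / ‖x‖⌉₊] with k hkx
    have h1 : 2 / ‖x‖ ≤ k := (Nat.le_ceil _).trans (by exact_mod_cast hkx)
    rw [div_le_iff₀ hx'] at h1
    rw [b.zero_of_le_dist, sub_zero]
    rw [dist_zero_right, norm_smul, Real.norm_of_nonneg (hk k).le]
    change (2 : ℝ) ≤ _
    nlinarith
  · rw [hfd, norm_neg, norm_smul, Real.norm_of_nonneg (hk k).le, mul_comm]
    exact mul_le_mul_of_nonneg_right (hM _) (hk k).le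
  · rw [hfd, fderiv_of_notMem_tsupport, smul_zero, neg_zero]
    rw [b.tsupport_eq, Metric.mem_closedBall, dist_zero_right, norm_smul,
      Real.norm_of_nonneg (hk k).le]
    rw [Metric.mem_closedBall, dist_zero_right, le_div_iff₀' (hk k)] at hx
    exact hx

theorem norm_gradient_mul_sq_le {η u : EuclideanSpace ℝ (Fin n) → ℝ}
    {x : EuclideanSpace ℝ (Fin n)} {L U M t : ℝ} (hη : DifferentiableAt ℝ η x)
    (hu : DifferentiableAt ℝ u x) (h0 : 0 ≤ η x) (h1 : η x ≤ 1) (ht : 1 ≤ t)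
    (hL : ‖fderiv ℝ u x‖ ≤ L) (hU : ‖u x‖ ≤ U) (hM : ‖fderiv ℝ η x‖ ≤ M * t) :
    ‖gradient (fun y => η y * u y) x‖ ^ 2 ≤
      ‖gradient u x‖ ^ 2 + (2 * L * U * M + (U * M) ^ 2) * t ^ 2 := by
  simp_rw [norm_gradient_eq_norm_fderiv]
  rw [fderiv_fun_mul hη hu]
  have hMt : 0 ≤ M * t := (norm_nonneg _).trans hM
  have hM0 : 0 ≤ M := nonneg_of_mul_nonneg_left hMt (by linarith)
  have hU0 : 0 ≤ U := (norm_nonneg _).trans hU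
  have hL0 : 0 ≤ L := (norm_nonneg _).trans hL
  have hle : ‖η x • fderiv ℝ u x + u x • fderiv ℝ η x‖ ≤ ‖fderiv ℝ u x‖ + U * (M * t) := by
    refine (norm_add_le _ _).trans (add_le_add ?_ ?_)
    · rw [norm_smul, Real.norm_of_nonneg h0]
      exact mul_le_of_le_one_left (norm_nonneg _) h1
    · rw [norm_smul]
      gcongr
  have hLU : ‖fderiv ℝ u x‖ * (U * M * t) ≤ L * (U * M * t) := by gcongr
  have ht2 : L * (U * M) * t ≤ L * (U * M) * t ^ 2 := by
    gcongr
    nlinarith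
  calc _ ≤ (‖fderiv ℝ u x‖ + U * (M * t)) ^ 2 := by gcongr
    _ ≤ _ := by nlinarith

theorem integral_indicator_closedBall_le (hn : 3 ≤ n) (k : ℕ) {C : ℝ} (hC : 0 ≤ C) :
    ∫ x, (Metric.closedBall (0 : EuclideanSpace ℝ (Fin n)) (2 / ((k : ℝ) + 1))).indicator
        (fun _ => C * ((k : ℝ) + 1) ^ 2) x ≤
      C * (2 ^ n * volume.real (Metric.ball (0 : EuclideanSpace ℝ (Fin n)) 1)) *
        (1 / ((k : ℝ) + 1)) := by
  have hk : (0 : ℝ) < k + 1 := by positivity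
  rw [integral_indicator Metric.isClosed_closedBall.measurableSet, setIntegral_const,
    measureReal_def, Measure.addHaar_closedBall _ _ (by positivity), ENNReal.toReal_mul,
    ENNReal.toReal_ofReal (by positivity), finrank_euclideanSpace_fin, ← measureReal_def,
    smul_eq_mul, div_pow]
  have h1 : 1 / ((k : ℝ) + 1) ^ n ≤ 1 / ((k : ℝ) + 1) ^ 3 :=
    one_div_le_one_div_of_le (by positivity) (pow_le_pow_right₀ (by simp) hn)
  have h2 := mul_le_mul_of_nonneg_left h1
    (show 0 ≤ C * (2 ^ n * volume.real (Metric.ball (0 : EuclideanSpace ℝ (Fin n)) 1)) *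
      ((k : ℝ) + 1) ^ 2 by positivity)
  refine (le_of_eq ?_).trans (h2.trans (le_of_eq ?_))
  · field_simp
  · field_simp

theorem integral_norm_gradient_cutoff_le (hn : 3 ≤ n) {s : ℝ} (h_s : 0 ≤ s) {M : ℝ}
    {η : ℕ → EuclideanSpace ℝ (Fin n) → ℝ} (hη : ∀ k, ContDiff ℝ (⊤ : ℕ∞) (η k))
    (h0 : ∀ k x, 0 ≤ η k x) (h1 : ∀ k x, η k x ≤ 1)
    (hM : ∀ k x, ‖fderiv ℝ (η k) x‖ ≤ M * (k + 1))
    (hoff : ∀ k : ℕ, ∀ x : EuclideanSpace ℝ (Fin n),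
      x ∉ Metric.closedBall 0 (2 / ((k : ℝ) + 1)) → fderiv ℝ (η k) x = 0)
    {u : EuclideanSpace ℝ (Fin n) → ℝ} (hu : ContDiff ℝ (⊤ : ℕ∞) u) (hc : HasCompactSupport u) :
    ∃ C : ℝ, ∀ k : ℕ, ∫ x, ‖x‖ ^ s * ‖gradient (fun y => η k y * u y) x‖ ^ 2 ≤
      (∫ x, ‖x‖ ^ s * ‖gradient u x‖ ^ 2) + C * (1 / ((k : ℝ) + 1)) := by
  obtain ⟨U, hU⟩ := hc.exists_bound_of_continuous hu.continuous
  obtain ⟨L, hL⟩ := (hc.fderiv ℝ).exists_bound_of_continuous (hu.continuous_fderiv (by simp))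
  have hM0 : 0 ≤ M := by simpa using (norm_nonneg _).trans (hM 0 0)
  have hU0 : 0 ≤ U := (norm_nonneg _).trans (hU 0)
  have hL0 : 0 ≤ L := (norm_nonneg _).trans (hL 0)
  set D := 2 ^ s * (2 * L * U * M + (U * M) ^ 2)
  have hD : 0 ≤ D := by positivity
  refine ⟨D * (2 ^ n * volume.real (Metric.ball (0 : EuclideanSpace ℝ (Fin n)) 1)),
    fun k => ?_⟩
  have hk : (1 : ℝ) ≤ k + 1 := by simp
  have hdu (x) : DifferentiableAt ℝ u x := hu.differentiable (by simp) x
  have hdη (x) : DifferentiableAt ℝ (η k) x := (hη k).differentiable (by simp) x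
  have hIv := integrable_norm_rpow_mul_norm_gradient_sq h_s ((hη k).mul hu) hc.mul_left
  have hIu := integrable_norm_rpow_mul_norm_gradient_sq h_s hu hc
  have hIb : Integrable ((Metric.closedBall (0 : EuclideanSpace ℝ (Fin n))
      (2 / ((k : ℝ) + 1))).indicator (fun _ => D * ((k : ℝ) + 1) ^ 2)) :=
    (integrable_indicator_iff Metric.isClosed_closedBall.measurableSet).2
      (integrableOn_const measure_closedBall_lt_top.ne)
  refine le_trans (integral_mono hIv (hIu.add hIb) fun x => ?_)
    ((integral_add hIu hIb).trans_le
      (add_le_add_right (integral_indicator_closedBall_le hn k hD) _))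
  by_cases hx : x ∈ Metric.closedBall (0 : EuclideanSpace ℝ (Fin n)) (2 / ((k : ℝ) + 1))
  · have hg := norm_gradient_mul_sq_le (hdη x) (hdu x) (h0 k x) (h1 k x) hk (hL x) (hU x) (hM k x)
    have hx2 : ‖x‖ ≤ 2 := by
      rw [Metric.mem_closedBall, dist_zero_right] at hx
      exact hx.trans (div_le_self zero_le_two hk)
    have hw : ‖x‖ ^ s ≤ 2 ^ s := Real.rpow_le_rpow (norm_nonneg _) hx2 h_s
    simp only [Pi.add_apply, Set.indicator_of_mem hx]
    calc _ ≤ ‖x‖ ^ s * (‖gradient u x‖ ^ 2 + (2 * L * U * M + (U * M) ^ 2) * ((k : ℝ) + 1) ^ 2) :=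
          mul_le_mul_of_nonneg_left hg (by positivity)
      _ = ‖x‖ ^ s * ‖gradient u x‖ ^ 2
          + ‖x‖ ^ s * (2 * L * U * M + (U * M) ^ 2) * ((k : ℝ) + 1) ^ 2 := by ring
      _ ≤ _ := by simp only [D]; gcongr
  · have hg := norm_gradient_mul_sq_le (M := 0) (hdη x) (hdu x) (h0 k x) (h1 k x) hk (hL x) (hU x)
      (by simp [hoff k x hx])
    simp only [Pi.add_apply, Set.indicator_of_notMem hx, add_zero]
    refine mul_le_mul_of_nonneg_left ?_ (by positivity)
    simpa using hg

theorem weighted_sobolev_of_tsupport_subset (hn : 3 ≤ n) {s p K : ℝ} (h_s : 0 ≤ s)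
    (hSobolev : ∀ f : EuclideanSpace ℝ (Fin n) → ℝ, ContDiff ℝ (⊤ : ℕ∞) f →
      HasCompactSupport f → tsupport f ⊆ {(0 : EuclideanSpace ℝ (Fin n))}ᶜ →
      (∫ x, |f x| ^ p) ^ (1 / p) ≤ K * (∫ x, ‖gradient f x‖ ^ 2) ^ ((1 : ℝ) / 2))
    {v : EuclideanSpace ℝ (Fin n) → ℝ} (hv : ContDiff ℝ (⊤ : ℕ∞) v) (hc : HasCompactSupport v)
    (h0 : tsupport v ⊆ {(0 : EuclideanSpace ℝ (Fin n))}ᶜ) :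
    (∫ x, |‖x‖ ^ s * v x| ^ p) ^ (2 / p) ≤
      K ^ 2 * ∫ x, ‖x‖ ^ (2 * s) * ‖gradient v x‖ ^ 2 := by
  have h := hSobolev _ (contDiff_norm_rpow_mul s hv h0) hc.mul_left
    ((closure_mono (Function.support_mul_subset_right _ _)).trans h0)
  have hI : 0 ≤ ∫ x, |‖x‖ ^ s * v x| ^ p := integral_nonneg fun x => by positivity
  have hJ : 0 ≤ ∫ x, ‖gradient (fun y => ‖y‖ ^ s * v y) x‖ ^ 2 :=
    integral_nonneg fun x => by positivity
  have h2 := pow_le_pow_left₀ (by positivity) h 2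
  rw [mul_pow, ← Real.rpow_mul_natCast hI, ← Real.rpow_mul_natCast hJ] at h2
  simp only [Nat.cast_ofNat, one_div, inv_mul_cancel₀ (two_ne_zero (α := ℝ)),
    Real.rpow_one] at h2
  rw [show 2 / p = p⁻¹ * 2 by ring]
  exact h2.trans (mul_le_mul_of_nonneg_left
    (integral_norm_gradient_norm_rpow_mul_le (by omega) h_s hv hc h0) (by positivity))

theorem weighted_sobolev (hn : 3 ≤ n) {s p K : ℝ} (h_s : 0 ≤ s) (hp : 0 < p)
    (hSobolev : ∀ f : EuclideanSpace ℝ (Fin n) → ℝ, ContDiff ℝ (⊤ : ℕ∞) f →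
      HasCompactSupport f → tsupport f ⊆ {(0 : EuclideanSpace ℝ (Fin n))}ᶜ →
      (∫ x, |f x| ^ p) ^ (1 / p) ≤ K * (∫ x, ‖gradient f x‖ ^ 2) ^ ((1 : ℝ) / 2))
    {u : EuclideanSpace ℝ (Fin n) → ℝ} (hu : ContDiff ℝ (⊤ : ℕ∞) u) (hc : HasCompactSupport u) :
    (∫ x, |‖x‖ ^ s * u x| ^ p) ^ (2 / p) ≤
      K ^ 2 * ∫ x, ‖x‖ ^ (2 * s) * ‖gradient u x‖ ^ 2 := by
  have : Nontrivial (EuclideanSpace ℝ (Fin n)) := by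
    have : Nonempty (Fin n) := ⟨⟨0, by omega⟩⟩
    infer_instance
  obtain ⟨M, η, -, hη, hη0, hη1, hηz, hηlim, hηM, hηoff⟩ := exists_cutoff_at_zero (n := n)
  obtain ⟨C, hC⟩ := integral_norm_gradient_cutoff_le (s := 2 * s) hn (by positivity) hη hη0 hη1
    hηM hηoff hu hc
  have hcut (k : ℕ) : (∫ x, |‖x‖ ^ s * (η k x * u x)| ^ p) ^ (2 / p) ≤
      K ^ 2 * ((∫ x, ‖x‖ ^ (2 * s) * ‖gradient u x‖ ^ 2) + C * (1 / ((k : ℝ) + 1))) := by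
    refine (weighted_sobolev_of_tsupport_subset hn h_s hSobolev ((hη k).mul hu) hc.mul_left
      ?_).trans (mul_le_mul_of_nonneg_left (hC k) (by positivity))
    refine (closure_mono (Function.support_mul_subset_left _ _)).trans fun x hx h => ?_
    rw [Set.mem_singleton_iff] at h
    exact notMem_tsupport_iff_eventuallyEq.2 (hηz k) (h ▸ hx)
  have hw : Continuous fun x : EuclideanSpace ℝ (Fin n) => ‖x‖ ^ s :=
    continuous_norm.rpow_const fun x => Or.inr h_s
  have hcont {f : EuclideanSpace ℝ (Fin n) → ℝ} (hf : Continuous f) :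
      Continuous fun x => |‖x‖ ^ s * f x| ^ p :=
    (hw.mul hf).abs.rpow_const fun x => Or.inr hp.le
  have hlim : Filter.Tendsto (fun k : ℕ => ∫ x, |‖x‖ ^ s * (η k x * u x)| ^ p) Filter.atTop
      (nhds (∫ x, |‖x‖ ^ s * u x| ^ p)) := by
    refine tendsto_integral_of_dominated_convergence (fun x => |‖x‖ ^ s * u x| ^ p)
      (fun k => (hcont ((hη k).continuous.mul hu.continuous)).aestronglyMeasurable)
      ((hcont hu.continuous).integrable_of_hasCompactSupport
        (hc.mono fun x hx h => hx (by simp [h, hp.ne']))) (fun k => ?_) ?_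
    · refine Filter.Eventually.of_forall fun x => ?_
      rw [Real.norm_of_nonneg (by positivity)]
      refine Real.rpow_le_rpow (abs_nonneg _) ?_ hp.le
      rw [abs_mul, abs_mul, abs_mul, abs_of_nonneg (hη0 k x)]
      exact mul_le_mul_of_nonneg_left (mul_le_of_le_one_left (abs_nonneg _) (hη1 k x))
        (abs_nonneg _)
    · filter_upwards [compl_mem_ae_iff.2 (measure_singleton (0 : EuclideanSpace ℝ (Fin n)))]
        with x hx
      refine tendsto_const_nhds.congr' ?_
      filter_upwards [hηlim x hx] with k hk
      rw [hk, one_mul]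
  have hR := ((tendsto_one_div_add_atTop_nhds_zero_nat (𝕜 := ℝ)).const_mul C).const_add
    (∫ x, ‖x‖ ^ (2 * s) * ‖gradient u x‖ ^ 2) |>.const_mul (K ^ 2)
  rw [mul_zero, add_zero] at hR
  exact le_of_tendsto_of_tendsto' (hlim.rpow_const (Or.inr (by positivity))) hR hcut

end

/-- Caffarelli-Kohn-Nirenberg inequality in the endpoint case `b = a` with
`a ≤ 0`, assuming the Sobolev inequality with constant `K`. -/
theorem ckn_b_eq_a_nonpos (n : ℕ) (hn : 3 ≤ n) (a p : ℝ)
    (ha0 : a ≤ 0) (hp : p = 2 * n / ((n : ℝ) - 2))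
    (K : ℝ) (hK : 0 < K)
    (hSobolev : ∀ f : EuclideanSpace ℝ (Fin n) → ℝ, ContDiff ℝ (⊤ : ℕ∞) f →
      HasCompactSupport f → tsupport f ⊆ {(0 : EuclideanSpace ℝ (Fin n))}ᶜ →
      (∫ x, |f x| ^ p) ^ (1 / p) ≤ K * (∫ x, ‖gradient f x‖ ^ 2) ^ ((1 : ℝ) / 2))
    (u : EuclideanSpace ℝ (Fin n) → ℝ)
    (hu : ContDiff ℝ (⊤ : ℕ∞) u) (hsupp : HasCompactSupport u) :
    (∫ x, |u x| ^ p / ‖x‖ ^ (a * p)) ^ (2 / p) ≤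
      K ^ 2 * (((n : ℝ) - 2 - 4 * a) / ((n : ℝ) - 2 - 2 * a)) ^ 2 *
        ∫ x, ‖gradient u x‖ ^ 2 / ‖x‖ ^ (2 * a) := by
  have hn' : (3 : ℝ) ≤ n := by exact_mod_cast hn
  have hp0 : 0 < p := by
    rw [hp]
    exact div_pos (by linarith) (by linarith)
  have hmain := weighted_sobolev (s := -a) hn (by linarith) hp0 hSobolev hu hsupp
  have hl (x : EuclideanSpace ℝ (Fin n)) : |u x| ^ p / ‖x‖ ^ (a * p) = |‖x‖ ^ (-a) * u x| ^ p := by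
    rw [abs_mul, abs_of_nonneg (Real.rpow_nonneg (norm_nonneg x) _),
      Real.mul_rpow (by positivity) (abs_nonneg _),
      ← Real.rpow_mul (norm_nonneg _), neg_mul, Real.rpow_neg (norm_nonneg _)]
    ring
  have hr (x : EuclideanSpace ℝ (Fin n)) : ‖gradient u x‖ ^ 2 / ‖x‖ ^ (2 * a) =
      ‖x‖ ^ (2 * -a) * ‖gradient u x‖ ^ 2 := by
    rw [mul_neg, Real.rpow_neg (norm_nonneg _)]
    ring
  simp_rw [hl, hr]
  have hI : 0 ≤ ∫ x, ‖x‖ ^ (2 * -a) * ‖gradient u x‖ ^ 2 :=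
    integral_nonneg fun x => by positivity
  refine hmain.trans (mul_le_mul_of_nonneg_right (le_mul_of_one_le_right (sq_nonneg K) ?_) hI)
  exact one_le_pow₀ ((one_le_div (by linarith)).2 (by linarith))
end

section
/- Let $n \geq 3$, let $a < \frac{n-2}{2}$, let $\theta \in [0,1]$, set $2^* = \frac{2n}{n-2}$, $p = 2(1-\theta) + 2^*\theta$, and $b = a + 1 - \frac{n\theta}{n-2+2\theta}$ (equivalently $p = \frac{2n}{n-2+2(b-a)}$ and $a \leq b \leq a+1$). Suppose $C_1 > 0$ satisfies $\int_{\mathbb{R}^n} \frac{|u(x)|^2}{\|x\|^{2(a+1)}}\,dx \leq C_1 \int_{\mathbb{R}^n} \frac{\|\nabla u(x)\|^2}{\|x\|^{2a}}\,dx$ for all $u \in C_c^\infty(\mathbb{R}^n)$, and $C_2 > 0$ satisfies $\left(\int_{\mathbb{R}^n} \frac{|u(x)|^{2^*}}{\|x\|^{2^* a}}\,dx\right)^{2/2^*} \leq C_2 \int_{\mathbb{R}^n} \frac{\|\nabla u(x)\|^2}{\|x\|^{2a}}\,dx$ for all $u \in C_c^\infty(\mathbb{R}^n)$. Then for every $u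 \in C_c^\infty(\mathbb{R}^n)$, $\left(\int_{\mathbb{R}^n} \frac{|u(x)|^p}{\|x\|^{bp}}\,dx\right)^{2/p} \leq C_2^{\alpha} C_1^{\beta} \int_{\mathbb{R}^n} \frac{\|\nabla u(x)\|^2}{\|x\|^{2a}}\,dx$, where $\alpha = \frac{2n\theta}{(n-2)p}$ and $\beta = \frac{2(1-\theta)}{p}$. -/
open MeasureTheory

/-- A continuous compactly supported function, raised to a positive power and divided by a
power of the norm below the dimension, is integrable. -/
theorem integrable_abs_rpow_div_norm_rpow {E : Type*} [NormedAddCommGroup E] [NormedSpace ℝ E]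
    [FiniteDimensional ℝ E] [MeasurableSpace E] [BorelSpace E] {μ : Measure E}
    [μ.IsAddHaarMeasure] (hdim : 1 ≤ Module.finrank ℝ E) {u : E → ℝ} (hu : Continuous u)
    (hsupp : HasCompactSupport u) {q s : ℝ} (hq : 0 < q) (hs : s < Module.finrank ℝ E) :
    Integrable (fun x => |u x| ^ q / ‖x‖ ^ s) μ := by
  obtain ⟨M, hM⟩ := hu.bounded_above_of_compact_support hsupp
  have hmeas : AEStronglyMeasurable (fun x => |u x| ^ q / ‖x‖ ^ s) μ := by
    have := hu.measurable
    exact Measurable.aestronglyMeasurable (by fun_prop)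
  have hloc : LocallyIntegrable (fun x => |u x| ^ q / ‖x‖ ^ s) μ := by
    refine locallyIntegrable_of_norm_le_rpow (C := M ^ q) hdim hs (ae_of_all _ fun x => ?_) hmeas
    have hx : |u x| ≤ M := hM x
    rw [Real.norm_of_nonneg (by positivity), Real.rpow_neg (norm_nonneg x), ← div_eq_mul_inv]
    gcongr
  refine (integrableOn_iff_integrable_of_support_subset ?_).1
    (hloc.integrableOn_isCompact hsupp)
  refine fun x hx => subset_tsupport u fun h => hx ?_
  simp [h, Real.zero_rpow hq.ne']

/-- Hölder's inequality with nonnegative weights of sum one, endpoints included. -/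
theorem integral_rpow_mul_rpow_le {X : Type*} [MeasurableSpace X] {μ : Measure X} {f g : X → ℝ}
    (hf : Integrable f μ) (hg : Integrable g μ) (hf0 : ∀ x, 0 ≤ f x) (hg0 : ∀ x, 0 ≤ g x)
    {s t : ℝ} (hs : 0 ≤ s) (ht : 0 ≤ t) (hst : s + t = 1) :
    ∫ x, f x ^ s * g x ^ t ∂μ ≤ (∫ x, f x ∂μ) ^ s * (∫ x, g x ∂μ) ^ t := by
  have hfI : 0 ≤ ∫ x, f x ∂μ := integral_nonneg hf0
  have hgI : 0 ≤ ∫ x, g x ∂μ := integral_nonneg hg0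
  have holder := ENNReal.lintegral_mul_norm_pow_le (μ := μ)
    hf.aestronglyMeasurable.aemeasurable.ennreal_ofReal
    hg.aestronglyMeasurable.aemeasurable.ennreal_ofReal hs ht hst
  rw [← ofReal_integral_eq_lintegral_ofReal hf (ae_of_all _ hf0),
    ← ofReal_integral_eq_lintegral_ofReal hg (ae_of_all _ hg0),
    ENNReal.ofReal_rpow_of_nonneg hfI hs, ENNReal.ofReal_rpow_of_nonneg hgI ht,
    ← ENNReal.ofReal_mul (by positivity)] at holder
  rw [integral_eq_lintegral_of_nonneg_ae
    (ae_of_all _ fun x => mul_nonneg (Real.rpow_nonneg (hf0 x) s) (Real.rpow_nonneg (hg0 x) t))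
    ((hf.aestronglyMeasurable.aemeasurable.pow_const s).mul
      (hg.aestronglyMeasurable.aemeasurable.pow_const t)).aestronglyMeasurable]
  refine ENNReal.toReal_le_of_le_ofReal (by positivity) (le_trans (le_of_eq ?_) holder)
  refine lintegral_congr fun x => ?_
  rw [ENNReal.ofReal_mul (Real.rpow_nonneg (hf0 x) s), ENNReal.ofReal_rpow_of_nonneg (hf0 x) hs,
    ENNReal.ofReal_rpow_of_nonneg (hg0 x) ht]

/-- Raising `|c| ^ q / r ^ s` and `|c| ^ q' / r ^ s'` to complementary powers and multiplying
interpolates the exponents linearly. -/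
theorem rpow_div_rpow_interpolate {c r q q' s s' θ : ℝ} (hc : 0 ≤ c) (hr : 0 < r) (hq : 0 < q)
    (hq' : 0 < q') (hθ0 : 0 ≤ θ) (hθ1 : θ ≤ 1) :
    (c ^ q / r ^ s) ^ (1 - θ) * (c ^ q' / r ^ s') ^ θ =
      c ^ (q * (1 - θ) + q' * θ) / r ^ (s * (1 - θ) + s' * θ) := by
  have hθ : 0 ≤ 1 - θ := sub_nonneg.2 hθ1
  rw [Real.div_rpow (by positivity) (by positivity), Real.div_rpow (by positivity) (by positivity),
    ← Real.rpow_mul hc, ← Real.rpow_mul hc, ← Real.rpow_mul hr.le, ← Real.rpow_mul hr.le,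
    div_mul_div_comm, ← Real.rpow_add hr,
    ← Real.rpow_add_of_nonneg hc (by positivity) (by positivity)]

/-- Caffarelli-Kohn-Nirenberg inequality for `a ≤ b ≤ a + 1`, obtained by
interpolation between the endpoint cases `b = a + 1` (constant `C₁`) and
`b = a` (constant `C₂`). -/
theorem ckn_interpolation (n : ℕ) (hn : 3 ≤ n) (a θ p b α β : ℝ)
    (ha : a < ((n : ℝ) - 2) / 2) (hθ0 : 0 ≤ θ) (hθ1 : θ ≤ 1)
    (hp : p = 2 * (1 - θ) + (2 * n / ((n : ℝ) - 2)) * θ)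
    (hb : b = a + 1 - (n : ℝ) * θ / ((n : ℝ) - 2 + 2 * θ))
    (hα : α = 2 * (n : ℝ) * θ / (((n : ℝ) - 2) * p))
    (hβ : β = 2 * (1 - θ) / p)
    (C₁ C₂ : ℝ) (hC₁ : 0 < C₁) (hC₂ : 0 < C₂)
    (h₁ : ∀ u : EuclideanSpace ℝ (Fin n) → ℝ, ContDiff ℝ (⊤ : ℕ∞) u → HasCompactSupport u →
      ∫ x, |u x| ^ 2 / ‖x‖ ^ (2 * (a + 1)) ≤
        C₁ * ∫ x, ‖gradient u x‖ ^ 2 / ‖x‖ ^ (2 * a))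
    (h₂ : ∀ u : EuclideanSpace ℝ (Fin n) → ℝ, ContDiff ℝ (⊤ : ℕ∞) u → HasCompactSupport u →
      (∫ x, |u x| ^ (2 * n / ((n : ℝ) - 2)) / ‖x‖ ^ ((2 * n / ((n : ℝ) - 2)) * a)) ^
          (2 / (2 * n / ((n : ℝ) - 2))) ≤
        C₂ * ∫ x, ‖gradient u x‖ ^ 2 / ‖x‖ ^ (2 * a))
    (u : EuclideanSpace ℝ (Fin n) → ℝ)
    (hu : ContDiff ℝ (⊤ : ℕ∞) u) (hsupp : HasCompactSupport u) :
    (∫ x, |u x| ^ p / ‖x‖ ^ (b * p)) ^ (2 / p) ≤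
      C₂ ^ α * C₁ ^ β * ∫ x, ‖gradient u x‖ ^ 2 / ‖x‖ ^ (2 * a) := by
  have hn' : (3 : ℝ) ≤ n := by exact_mod_cast hn
  have hn2 : 0 < (n : ℝ) - 2 := by linarith
  have hθ : 0 ≤ 1 - θ := sub_nonneg.2 hθ1
  have hdim : Module.finrank ℝ (EuclideanSpace ℝ (Fin n)) = n := by simp
  have : Nonempty (Fin n) := ⟨⟨0, by omega⟩⟩
  set q : ℝ := 2 * n / ((n : ℝ) - 2) with hq
  have hq0 : 0 < q := by positivity
  have hp' : p = 2 * ((n : ℝ) - 2 + 2 * θ) / ((n : ℝ) - 2) := by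
    rw [hp, hq]; field_simp; ring
  have hp0 : 0 < p := by rw [hp']; positivity
  have hbp : b * p = 2 * (a + 1) * (1 - θ) + q * a * θ := by
    have : (n : ℝ) - 2 + 2 * θ ≠ 0 := by positivity
    rw [hb, hp', hq]; field_simp; ring
  have hα' : α = θ * q / p := by rw [hα, hq]; field_simp
  have hαβ : α + β = 1 := by rw [hα', hβ, ← add_div, div_eq_one_iff_eq hp0.ne', hp]; ring
  have hα0 : 0 ≤ α := by rw [hα']; positivity
  have hβ0 : 0 ≤ β := by rw [hβ]; positivity
  have hA := h₁ u hu hsupp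
  have hB := h₂ u hu hsupp
  simp only [← Real.rpow_two (|u _|)] at hA
  set D := ∫ x, ‖gradient u x‖ ^ 2 / ‖x‖ ^ (2 * a)
  have hD : 0 ≤ D := integral_nonneg fun x => by positivity
  have hf : Integrable fun x => |u x| ^ (2 : ℝ) / ‖x‖ ^ (2 * (a + 1)) :=
    integrable_abs_rpow_div_norm_rpow (by omega) hu.continuous hsupp two_pos
      (by rw [hdim]; linarith)
  have hg : Integrable fun x => |u x| ^ q / ‖x‖ ^ (q * a) := by
    refine integrable_abs_rpow_div_norm_rpow (by omega) hu.continuous hsupp hq0 ?_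
    calc q * a < q * (((n : ℝ) - 2) / 2) := by gcongr
      _ = _ := by rw [hdim, hq]; field_simp
  have holder := integral_rpow_mul_rpow_le hf hg (fun x => by positivity)
    (fun x => by positivity) hθ hθ0 (by ring)
  have heq : ∫ x, |u x| ^ p / ‖x‖ ^ (b * p) =
      ∫ x, (|u x| ^ (2 : ℝ) / ‖x‖ ^ (2 * (a + 1))) ^ (1 - θ) *
        (|u x| ^ q / ‖x‖ ^ (q * a)) ^ θ := by
    refine integral_congr_ae ?_
    filter_upwards [Measure.ae_ne volume 0] with x hx
    rw [rpow_div_rpow_interpolate (abs_nonneg _) (norm_pos_iff.2 hx) two_pos hq0 hθ0 hθ1,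
      ← hp, ← hbp]
  rw [← heq] at holder
  set A := ∫ x, |u x| ^ (2 : ℝ) / ‖x‖ ^ (2 * (a + 1))
  set B := ∫ x, |u x| ^ q / ‖x‖ ^ (q * a)
  have hA0 : 0 ≤ A := integral_nonneg fun x => by positivity
  have hB0 : 0 ≤ B := integral_nonneg fun x => by positivity
  calc (∫ x, |u x| ^ p / ‖x‖ ^ (b * p)) ^ (2 / p)
      ≤ (A ^ (1 - θ) * B ^ θ) ^ (2 / p) :=
        Real.rpow_le_rpow (integral_nonneg fun x => by positivity) holder (by positivity)
    _ = (B ^ (2 / q)) ^ α * A ^ β := by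
        rw [Real.mul_rpow (by positivity) (by positivity), ← Real.rpow_mul hA0,
          ← Real.rpow_mul hB0, ← Real.rpow_mul hB0, mul_comm, hα', hβ]
        congr 2 <;> field_simp
    _ ≤ (C₂ * D) ^ α * (C₁ * D) ^ β := by gcongr
    _ = C₂ ^ α * C₁ ^ β * (D ^ α * D ^ β) := by
        rw [Real.mul_rpow hC₂.le hD, Real.mul_rpow hC₁.le hD]; ring
    _ = C₂ ^ α * C₁ ^ β * D := by
        rw [← Real.rpow_add_of_nonneg hD hα0 hβ0, hαβ, Real.rpow_one]
end

section
/- Let $n > 4$ and let $u \in C_c^\infty(\mathbb{R}^n)$. Then $\int_{\mathbb{R}^n} \frac{|u(x)|^2}{\|x\|^4}\,dx \leq \left(\frac{4}{n(n-4)}\right)^2 \int_{\mathbb{R}^n} |\Delta u(x)|^2\,dx$. -/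
open MeasureTheory

/-- The integral of a directional derivative of a compactly supported `C¹` function vanishes. -/
lemma integral_fderiv_apply_eq_zero_of_hasCompactSupport {E : Type*} [NormedAddCommGroup E]
    [NormedSpace ℝ E] [MeasurableSpace E] [BorelSpace E] [FiniteDimensional ℝ E]
    (μ : Measure E) [μ.IsAddHaarMeasure] {f : E → ℝ} (hf : ContDiff ℝ 1 f)
    (hsupp : HasCompactSupport f) (v : E) : ∫ x, fderiv ℝ f x v ∂μ = 0 := by
  have hint : Integrable f μ := hf.continuous.integrable_of_hasCompactSupport hsupp
  have hint' : Integrable (fun x => fderiv ℝ f x v) μ :=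
    ((hf.continuous_fderiv one_ne_zero).clm_apply continuous_const).integrable_of_hasCompactSupport
      (hsupp.fderiv_apply (𝕜 := ℝ) v)
  have h := integral_mul_fderiv_eq_neg_fderiv_mul_of_integrable (μ := μ) (𝕜 := ℝ)
    (f := fun _ : E => (1 : ℝ)) (g := f) (v := v) (by simp) (by simpa using hint')
    (by simpa using hint) (fun _ _ => differentiableAt_const _)
    fun x _ => hf.differentiable one_ne_zero x
  simpa using h

/-- The `i`-th component of the vector field `u ∇u / ρ + b u² x / ρ²`, where `ρ = ‖x‖² + ε`. -/
noncomputable def rellichField {n : ℕ} (u : EuclideanSpace ℝ (Fin n) → ℝ) (ε b : ℝ) (i : Fin n)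
    (x : EuclideanSpace ℝ (Fin n)) : ℝ :=
  u x * (fderiv ℝ u x (EuclideanSpace.single i 1) * (‖x‖ ^ 2 + ε)⁻¹ +
    b * (u x * (x i * ((‖x‖ ^ 2 + ε)⁻¹ * (‖x‖ ^ 2 + ε)⁻¹))))

section

variable {n : ℕ} {u : EuclideanSpace ℝ (Fin n) → ℝ}

lemma contDiff_fderiv_single (hu : ContDiff ℝ (⊤ : ℕ∞) u) (i : Fin n) :
    ContDiff ℝ (⊤ : ℕ∞) (fun x => fderiv ℝ u x (EuclideanSpace.single i 1)) :=
  (hu.fderiv_right (by simp)).clm_apply contDiff_const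

lemma contDiff_rellichField (hu : ContDiff ℝ (⊤ : ℕ∞) u) {ε : ℝ} (hε : 0 < ε) (b : ℝ)
    (i : Fin n) : ContDiff ℝ 1 (rellichField u ε b i) := by
  have hw : ContDiff ℝ 1 (fun x : EuclideanSpace ℝ (Fin n) => (‖x‖ ^ 2 + ε)⁻¹) :=
    ((contDiff_norm_sq ℝ).add contDiff_const).inv fun x => by positivity
  have hu' : ContDiff ℝ 1 u := hu.of_le (by exact_mod_cast le_top)
  have hp := (contDiff_fderiv_single hu i).of_le (m := 1) (by exact_mod_cast le_top)
  have hx : ContDiff ℝ 1 (fun x : EuclideanSpace ℝ (Fin n) => x i) :=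
    (EuclideanSpace.proj i : EuclideanSpace ℝ (Fin n) →L[ℝ] ℝ).contDiff
  exact hu'.mul ((hp.mul hw).add (contDiff_const.mul (hu'.mul (hx.mul (hw.mul hw)))))

lemma hasCompactSupport_rellichField (hsupp : HasCompactSupport u) (ε b : ℝ) (i : Fin n) :
    HasCompactSupport (rellichField u ε b i) :=
  hsupp.mul_right

lemma fderiv_rellichField (hu : ContDiff ℝ (⊤ : ℕ∞) u) {ε : ℝ} (hε : 0 < ε) (b : ℝ)
    (i : Fin n) (x : EuclideanSpace ℝ (Fin n)) :
    fderiv ℝ (rellichField u ε b i) x (EuclideanSpace.single i 1) =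
      u x * (‖x‖ ^ 2 + ε)⁻¹ * fderiv ℝ (fun y => fderiv ℝ u y (EuclideanSpace.single i 1)) x
          (EuclideanSpace.single i 1) +
        (‖x‖ ^ 2 + ε)⁻¹ * fderiv ℝ u x (EuclideanSpace.single i 1) ^ 2 +
        2 * (b - 1) * u x * (‖x‖ ^ 2 + ε)⁻¹ ^ 2 *
          (fderiv ℝ u x (EuclideanSpace.single i 1) * x i) +
        b * u x ^ 2 * (‖x‖ ^ 2 + ε)⁻¹ ^ 2 -
        4 * b * u x ^ 2 * (‖x‖ ^ 2 + ε)⁻¹ ^ 3 * x i ^ 2 := by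
  have hne : ‖x‖ ^ 2 + ε ≠ 0 := by positivity
  have hU : HasFDerivAt u (fderiv ℝ u x) x :=
    (hu.differentiable (by simp) x).hasFDerivAt
  have hP := ((contDiff_fderiv_single hu i).differentiable (by simp) x).hasFDerivAt
  have hX : HasFDerivAt (fun x : EuclideanSpace ℝ (Fin n) => x i)
      (EuclideanSpace.proj i : EuclideanSpace ℝ (Fin n) →L[ℝ] ℝ) x :=
    (EuclideanSpace.proj i : EuclideanSpace ℝ (Fin n) →L[ℝ] ℝ).hasFDerivAt
  have hρ : HasFDerivAt (fun x : EuclideanSpace ℝ (Fin n) => ‖x‖ ^ 2 + ε)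
      (2 • innerSL ℝ x) x := (hasStrictFDerivAt_norm_sq x).hasFDerivAt.add_const ε
  have hW := (hasDerivAt_inv hne).comp_hasFDerivAt x hρ
  have hF := hU.mul ((hP.mul hW).add ((hU.mul (hX.mul (hW.mul hW))).const_mul b))
  have h : fderiv ℝ (rellichField u ε b i) x = _ := hF.fderiv
  rw [h]
  simp [EuclideanSpace.inner_single_right]
  field_simp
  ring

lemma rellich_pointwise_lower_bound {ι : Type*} [Fintype ι] (p x : ι → ℝ) (a u w ε d m c : ℝ)
    (hw : 0 < w) (hε : 0 ≤ ε) (ha : 0 ≤ a) (hc : 0 < c) (hm : m = 2 * a + 4)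
    (hca : c = a ^ 2 + 2 * a) (hwx : w * (∑ i, x i ^ 2) = 1 - ε * w) :
    c / 2 * (u * w) ^ 2 - (2 * c)⁻¹ * d ^ 2 ≤
      u * w * d + w * ∑ i, p i ^ 2 + 2 * a * u * w ^ 2 * ∑ i, p i * x i +
        m * ((a + 1) * u ^ 2 * w ^ 2) - 4 * (a + 1) * u ^ 2 * w ^ 3 * ∑ i, x i ^ 2 := by
  have hsq : 0 ≤ ∑ i, (p i + a * u * w * x i) ^ 2 := Finset.sum_nonneg fun i _ => sq_nonneg _
  have hexp : ∑ i, (p i + a * u * w * x i) ^ 2 =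
      ∑ i, p i ^ 2 + 2 * (a * u * w) * ∑ i, p i * x i + (a * u * w) ^ 2 * ∑ i, x i ^ 2 := by
    simp only [Finset.mul_sum, ← Finset.sum_add_distrib]
    exact Finset.sum_congr rfl fun i _ => by ring
  rw [hexp] at hsq
  have h1 := mul_nonneg hw.le hsq
  have h2 : 0 ≤ (2 * c)⁻¹ * (d + c * (u * w)) ^ 2 := by positivity
  have h3 : (2 * c)⁻¹ * (d + c * (u * w)) ^ 2 =
      (2 * c)⁻¹ * d ^ 2 + u * w * d + c / 2 * (u * w) ^ 2 := by
    field_simp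
    ring
  have h4 : 0 ≤ ε * w * (a + 2) ^ 2 * (u * w) ^ 2 := by positivity
  generalize ∑ i, x i ^ 2 = R at *
  generalize ∑ i, p i ^ 2 = P at *
  generalize ∑ i, p i * x i = S at *
  have h5 : (u * w) ^ 2 * (a + 2) ^ 2 * (w * R) = (u * w) ^ 2 * (a + 2) ^ 2 * (1 - ε * w) := by
    rw [hwx]
  subst hm
  have h6 : c * (u * w) ^ 2 = (a ^ 2 + 2 * a) * (u * w) ^ 2 := by rw [hca]
  linarith

/-- A version of Rellich's inequality in which the singular weight is regularized. -/
lemma rellich_inequality_regularized (hn : 4 < n) (hu : ContDiff ℝ (⊤ : ℕ∞) u)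
    (hsupp : HasCompactSupport u) {ε : ℝ} (hε : 0 < ε) :
    ∫ x, (u x * (‖x‖ ^ 2 + ε)⁻¹) ^ 2 ≤
      (4 / ((n : ℝ) * ((n : ℝ) - 4))) ^ 2 *
        ∫ x, (∑ i : Fin n,
          fderiv ℝ (fun y => fderiv ℝ u y (EuclideanSpace.single i 1)) x
            (EuclideanSpace.single i 1)) ^ 2 := by
  have hn' : (4 : ℝ) < n := by exact_mod_cast hn
  obtain ⟨a, ha⟩ : ∃ a : ℝ, (n : ℝ) = 2 * a + 4 := ⟨((n : ℝ) - 4) / 2, by ring⟩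
  have ha0 : 0 < a := by linarith
  set c : ℝ := a ^ 2 + 2 * a with hc
  have hc0 : 0 < c := by positivity
  set D : EuclideanSpace ℝ (Fin n) → ℝ := fun x => ∑ i : Fin n,
    fderiv ℝ (fun y => fderiv ℝ u y (EuclideanSpace.single i 1)) x
      (EuclideanSpace.single i 1) with hD
  have hint₁ : Integrable (fun x => (u x * (‖x‖ ^ 2 + ε)⁻¹) ^ 2) := by
    refine Continuous.integrable_of_hasCompactSupport ?_ ?_
    · refine (hu.continuous.mul (Continuous.inv₀ (by fun_prop) fun x => ?_)).pow 2
      positivity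
    · simp only [pow_two]
      exact hsupp.mul_right.mul_right
  have hint₂ : Integrable (fun x => D x ^ 2) := by
    refine Continuous.integrable_of_hasCompactSupport ?_ ?_
    · refine (continuous_finsetSum _ fun i _ => ?_).pow 2
      exact (((contDiff_fderiv_single hu i).fderiv_right (m := 0) (by simp)).clm_apply
        contDiff_const).continuous
    · refine HasCompactSupport.intro hsupp fun x hx => ?_
      have h0 : ∀ i : Fin n, fderiv ℝ (fun y => fderiv ℝ u y (EuclideanSpace.single i 1)) x
          (EuclideanSpace.single i 1) = 0 := fun i => by
        refine image_eq_zero_of_notMem_tsupport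
          (f := fun x => fderiv ℝ (fun y => fderiv ℝ u y (EuclideanSpace.single i 1)) x
            (EuclideanSpace.single i 1)) fun h => hx ?_
        exact tsupport_fderiv_apply_subset ℝ _ (tsupport_fderiv_apply_subset ℝ _ h)
      simp [hD, h0]
  have hint₃ : ∀ i ∈ Finset.univ, Integrable fun x =>
      fderiv ℝ (rellichField u ε (a + 1) i) x (EuclideanSpace.single i 1) := fun i _ =>
    (((contDiff_rellichField hu hε (a + 1) i).continuous_fderiv one_ne_zero).clm_apply
      continuous_const).integrable_of_hasCompactSupport
        ((hasCompactSupport_rellichField hsupp ε (a + 1) i).fderiv_apply (𝕜 := ℝ) _)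
  have hdiv :
      ∫ x, ∑ i, fderiv ℝ (rellichField u ε (a + 1) i) x (EuclideanSpace.single i 1) = 0 := by
    rw [integral_finsetSum _ hint₃]
    exact Finset.sum_eq_zero fun i _ => integral_fderiv_apply_eq_zero_of_hasCompactSupport _
      (contDiff_rellichField hu hε _ i) (hasCompactSupport_rellichField hsupp _ _ i) _
  have hle : ∫ x, (c / 2 * (u x * (‖x‖ ^ 2 + ε)⁻¹) ^ 2 - (2 * c)⁻¹ * D x ^ 2) ≤ 0 := by
    rw [← hdiv]
    refine integral_mono ((hint₁.const_mul _).sub (hint₂.const_mul _))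
      (integrable_finsetSum _ hint₃) fun x => ?_
    have hwx : (‖x‖ ^ 2 + ε)⁻¹ * ∑ i, x i ^ 2 = 1 - ε * (‖x‖ ^ 2 + ε)⁻¹ := by
      rw [← EuclideanSpace.real_norm_sq_eq]
      field_simp
      ring
    refine (rellich_pointwise_lower_bound
      (fun i => fderiv ℝ u x (EuclideanSpace.single i 1)) x a (u x) (‖x‖ ^ 2 + ε)⁻¹ ε (D x) n c
      (by positivity) hε.le ha0.le hc0 ha hc hwx).trans_eq ?_
    simp only [fderiv_rellichField hu hε, Finset.sum_add_distrib, Finset.sum_sub_distrib,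
      ← Finset.mul_sum, hD, Finset.sum_const, Finset.card_univ, Fintype.card_fin, nsmul_eq_mul,
      add_sub_cancel_right]
    ring
  rw [integral_sub (hint₁.const_mul _) (hint₂.const_mul _), integral_const_mul,
    integral_const_mul] at hle
  have hconst : 4 / ((n : ℝ) * ((n : ℝ) - 4)) = c⁻¹ := by
    rw [ha, hc]
    field_simp
    ring
  rw [hconst]
  calc ∫ x, (u x * (‖x‖ ^ 2 + ε)⁻¹) ^ 2
      = 2 * c⁻¹ * (c / 2 * ∫ x, (u x * (‖x‖ ^ 2 + ε)⁻¹) ^ 2) := by field_simp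
    _ ≤ 2 * c⁻¹ * ((2 * c)⁻¹ * ∫ x, D x ^ 2) :=
        mul_le_mul_of_nonneg_left (by linarith) (by positivity)
    _ = c⁻¹ ^ 2 * ∫ x, D x ^ 2 := by field_simp

end

/-- Rellich's inequality with sharp constant `(4 / (n (n - 4)))^2`. The
Laplacian is written as the sum of the pure second partial derivatives. -/
theorem rellich_inequality (n : ℕ) (hn : 4 < n)
    (u : EuclideanSpace ℝ (Fin n) → ℝ)
    (hu : ContDiff ℝ (⊤ : ℕ∞) u) (hsupp : HasCompactSupport u) :
    ∫ x, |u x| ^ 2 / ‖x‖ ^ 4 ≤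
      (4 / ((n : ℝ) * ((n : ℝ) - 4))) ^ 2 *
        ∫ x, |∑ i : Fin n,
          fderiv ℝ (fun y => fderiv ℝ u y (EuclideanSpace.single i 1)) x
            (EuclideanSpace.single i 1)| ^ 2 := by
  simp only [sq_abs]
  by_cases hint : Integrable fun x => u x ^ 2 / ‖x‖ ^ 4
  swap
  · rw [integral_undef hint]
    exact mul_nonneg (sq_nonneg _) (integral_nonneg fun x => sq_nonneg _)
  have : Nonempty (Fin n) := ⟨⟨0, by omega⟩⟩
  have hx0 : ∀ᵐ x : EuclideanSpace ℝ (Fin n), x ≠ 0 := Measure.ae_ne volume 0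
  refine le_of_tendsto (x := nhdsWithin (0 : ℝ) (Set.Ioi 0))
    (f := fun ε : ℝ => ∫ x, (u x * (‖x‖ ^ 2 + ε)⁻¹) ^ 2) ?_
    (eventually_nhdsWithin_of_forall fun ε hε =>
      rellich_inequality_regularized hn hu hsupp hε)
  refine tendsto_integral_filter_of_dominated_convergence _ ?_ ?_ hint ?_
  · refine eventually_nhdsWithin_of_forall fun ε (hε : 0 < ε) => Continuous.aestronglyMeasurable ?_
    refine (hu.continuous.mul (Continuous.inv₀ (by fun_prop) fun x => ?_)).pow 2
    positivity
  · refine eventually_nhdsWithin_of_forall fun ε (hε : 0 < ε) => ?_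
    filter_upwards [hx0] with x hx
    have hpos : 0 < ‖x‖ := norm_pos_iff.mpr hx
    rw [Real.norm_of_nonneg (sq_nonneg _), mul_pow, inv_pow, ← div_eq_mul_inv,
      show ‖x‖ ^ 4 = (‖x‖ ^ 2) ^ 2 by ring]
    gcongr
    linarith
  · filter_upwards [hx0] with x hx
    have hpos : 0 < ‖x‖ := norm_pos_iff.mpr hx
    have hlim : Filter.Tendsto (fun ε : ℝ => (u x * (‖x‖ ^ 2 + ε)⁻¹) ^ 2) (nhds 0)
        (nhds ((u x * (‖x‖ ^ 2 + 0)⁻¹) ^ 2)) := by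
      refine ContinuousAt.tendsto (f := fun ε : ℝ => (u x * (‖x‖ ^ 2 + ε)⁻¹) ^ 2) ?_
      refine (continuousAt_const.mul (ContinuousAt.inv₀ (by fun_prop) ?_)).pow 2
      positivity
    have heq : (u x * (‖x‖ ^ 2 + 0)⁻¹) ^ 2 = u x ^ 2 / ‖x‖ ^ 4 := by
      field_simp
      ring
    rw [heq] at hlim
    exact hlim.mono_left nhdsWithin_le_nhds
end
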